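/- Let N ≥ 1 and let (u,v) be a solution of the system Δu = u v², Δv = v u², u > 0, v > 0 on ℝ^N satisfying the algebraic growth condition: there exist C > 0 and α ≥ 1 such that u(x) + v(x) ≤ C(1 + |x|)^α for all x ∈ ℝ^N. Then the limit 𝒩(∞) := lim_{r→∞} 𝒩(r) of the Almgren frequency function exists (the frequency function being nondecreasing in r) and satisfies 𝒩(∞) ≤ α. -/

import Mathlib

open MeasureTheory Metric Filter

/-- The Laplacian of `f : ℝᴺ → ℝ`, as the sum of the second partial derivatives. -/
noncomputable def lapl {N : ℕ} (f : EuclideanSpace ℝ (Fin N) → ℝ)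
    (x : EuclideanSpace ℝ (Fin N)) : ℝ :=
  ∑ i, fderiv ℝ (fun y => fderiv ℝ f y (EuclideanSpace.single i 1)) x (EuclideanSpace.single i 1)

/-- The Almgren frequency function
`𝒩(r) = r ∫_{B_r(0)} (|∇u|² + |∇v|² + u²v²) / ∫_{∂B_r(0)} (u² + v²)`,
the numerator being a Lebesgue integral over the ball and the denominator an integral
over the sphere with respect to the `(N-1)`-dimensional (Hausdorff) surface measure. -/
noncomputable def freq {N : ℕ} (u v : EuclideanSpace ℝ (Fin N) → ℝ) (r : ℝ) : ℝ :=
  r * (∫ x in ball (0 : EuclideanSpace ℝ (Fin N)) r,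
        (‖gradient u x‖ ^ 2 + ‖gradient v x‖ ^ 2 + (u x) ^ 2 * (v x) ^ 2)) /
    ∫ x in sphere (0 : EuclideanSpace ℝ (Fin N)) r, ((u x) ^ 2 + (v x) ^ 2) ∂(μH[(N : ℝ) - 1])

section almgren_helpers
open MeasureTheory Metric Filter Set
open scoped ENNReal NNReal Topology Pointwise

theorem unif_fubini {X : Type*} [PseudoMetricSpace X] [MeasurableSpace X] [BorelSpace X]
    [SecondCountableTopology X] (μ ν : Measure X) [IsFiniteMeasure μ] [IsFiniteMeasure ν]
    (U : Set X) (hU : MeasurableSet U) (r : ℝ) :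
    ∫⁻ x in U, ν (U ∩ ball x r) ∂μ = ∫⁻ y in U, μ (U ∩ ball y r) ∂ν := by
  have hm : MeasurableSet {p : X × X | dist p.1 p.2 < r} :=
    measurableSet_lt (by fun_prop) (by fun_prop)
  have h1 := Measure.prod_apply (μ := μ.restrict U) (ν := ν.restrict U) hm
  have h2 := Measure.prod_apply_symm (μ := μ.restrict U) (ν := ν.restrict U) hm
  rw [h1] at h2
  convert h2 using 1
  · apply lintegral_congr; intro x
    rw [Measure.restrict_apply (measurable_prodMk_left hm), inter_comm]
    congr 2; ext y; simp [dist_comm]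
  · apply lintegral_congr; intro x
    rw [Measure.restrict_apply (measurable_prodMk_right hm), inter_comm]
    congr 2

theorem unif_open_le {X : Type*} [PseudoMetricSpace X] [MeasurableSpace X] [BorelSpace X]
    [SecondCountableTopology X] (μ ν : Measure X) [IsFiniteMeasure μ] [IsFiniteMeasure ν]
    (g h : ℝ → ℝ≥0∞) (hg : ∀ x, ∀ r > 0, μ (ball x r) = g r) (hh : ∀ x, ∀ r > 0, ν (ball x r) = h r)
    (hpos : ∀ r > 0, h r ≠ 0) [Nonempty X] (c : ℝ≥0∞)
    (hc : μ univ = c * ν univ) (U : Set X) (hU : IsOpen U) : μ U ≤ c * ν U := by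
  have hν0 : ν univ ≠ 0 := by
    intro h0
    obtain ⟨x⟩ := ‹Nonempty X›
    exact hpos 1 one_pos (by rw [← hh x 1 one_pos]; exact measure_mono_null (subset_univ _) h0)
  have hfin : ∀ r > 0, h r ≠ ∞ := by
    intro r hr
    obtain ⟨x⟩ := ‹Nonempty X›
    rw [← hh x r hr]; finiteness
  have hgh : ∀ r > 0, g r = c * h r := by
    intro r hr
    have := unif_fubini μ ν univ .univ r
    simp only [univ_inter, Measure.restrict_univ] at this
    rw [lintegral_congr (fun x => hh x r hr), lintegral_congr (fun x => hg x r hr)] at this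
    rw [lintegral_const, lintegral_const, hc, ← mul_assoc] at this
    have := (ENNReal.mul_left_inj hν0 (by finiteness)).1 this
    rw [← this, mul_comm]
  let ρ : ℕ → ℝ := fun n => 1 / ((n : ℝ) + 1)
  have hρ : ∀ n, 0 < ρ n := fun n => Nat.one_div_pos_of_nat
  have hmeas : ∀ n, Measurable (fun x => ν (U ∩ ball x (ρ n)) / h (ρ n)) := by
    intro n
    apply Measurable.div_const
    have hm : MeasurableSet {p : X × X | dist p.1 p.2 < ρ n} :=
      measurableSet_lt (by fun_prop) (by fun_prop)
    have := measurable_measure_prodMk_left (ν := ν.restrict U) hm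
    convert this using 2 with x
    rw [Measure.restrict_apply (measurable_prodMk_left hm), inter_comm]
    congr 2; ext y; simp [dist_comm]
  calc μ U = ∫⁻ x in U, 1 ∂μ := by simp
    _ ≤ ∫⁻ x in U, liminf (fun n => ν (U ∩ ball x (ρ n)) / h (ρ n)) atTop ∂μ := by
        apply setLIntegral_mono' hU.measurableSet
        intro x hx
        obtain ⟨ε, hε, hb⟩ := Metric.isOpen_iff.1 hU x hx
        apply le_liminf_of_le (by isBoundedDefault)
        have ht : Tendsto ρ atTop (𝓝 0) := tendsto_one_div_add_atTop_nhds_zero_nat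
        filter_upwards [ht.eventually (gt_mem_nhds hε)] with n hn
        rw [inter_eq_self_of_subset_right ((ball_subset_ball hn.le).trans hb), hh x _ (hρ n),
          ENNReal.div_self (hpos _ (hρ n)) (hfin _ (hρ n))]
    _ ≤ liminf (fun n => ∫⁻ x in U, ν (U ∩ ball x (ρ n)) / h (ρ n) ∂μ) atTop :=
        lintegral_liminf_le hmeas
    _ ≤ c * ν U := by
        apply liminf_le_of_le (by isBoundedDefault)
        intro b hb
        obtain ⟨n, hn⟩ := hb.exists
        refine hn.trans ?_
        simp only [div_eq_mul_inv]
        rw [lintegral_mul_const' _ _ (ENNReal.inv_ne_top.2 (hpos _ (hρ n))),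
          unif_fubini μ ν U hU.measurableSet]
        calc (∫⁻ y in U, μ (U ∩ ball y (ρ n)) ∂ν) * (h (ρ n))⁻¹
            ≤ (∫⁻ y in U, g (ρ n) ∂ν) * (h (ρ n))⁻¹ := by
              gcongr with y
              rw [← hg y _ (hρ n)]
              exact measure_mono inter_subset_right
          _ = c * ν U := by
              rw [lintegral_const, hgh _ (hρ n), Measure.restrict_apply_univ, mul_right_comm c,
                mul_assoc, ENNReal.mul_inv_cancel (hpos _ (hρ n)) (hfin _ (hρ n)), mul_one]

theorem unif_eq {X : Type*} [PseudoMetricSpace X] [MeasurableSpace X] [BorelSpace X]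
    [SecondCountableTopology X] (μ ν : Measure X) [IsFiniteMeasure μ] [IsFiniteMeasure ν]
    (g h : ℝ → ℝ≥0∞) (hg : ∀ x, ∀ r > 0, μ (ball x r) = g r) (hh : ∀ x, ∀ r > 0, ν (ball x r) = h r)
    (hgpos : ∀ r > 0, g r ≠ 0)
    (hpos : ∀ r > 0, h r ≠ 0) [Nonempty X] (c : ℝ≥0)
    (hc : μ univ = c * ν univ) : μ = c • ν := by
  have hμ0 : μ univ ≠ 0 := by
    intro h0
    obtain ⟨x⟩ := ‹Nonempty X›
    exact hgpos 1 one_pos (by rw [← hg x 1 one_pos]; exact measure_mono_null (subset_univ _) h0)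
  have hc0 : (c : ℝ≥0∞) ≠ 0 := by
    intro h; rw [h, zero_mul] at hc; exact hμ0 hc
  have hci : (c : ℝ≥0∞) ≠ ∞ := ENNReal.coe_ne_top
  have key : ∀ U, IsOpen U → μ U = (c • ν) U := by
    intro U hU
    apply le_antisymm
    · have := unif_open_le μ ν g h hg hh hpos c hc U hU
      simpa using this
    · have h2 : ν univ = (c : ℝ≥0∞)⁻¹ * μ univ := by
        rw [hc, ← mul_assoc, ENNReal.inv_mul_cancel hc0 hci, one_mul]
      have := unif_open_le ν μ h g hh hg hgpos _ h2 U hU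
      calc (c • ν) U = c * ν U := by simp
        _ ≤ c * ((c : ℝ≥0∞)⁻¹ * μ U) := by gcongr
        _ = μ U := by rw [← mul_assoc, ENNReal.mul_inv_cancel hc0 hci, one_mul]
  refine ext_of_generate_finite _ BorelSpace.measurable_eq isPiSystem_isOpen (fun s hs => key s hs) (key _ isOpen_univ)


theorem cap_eq {N : ℕ} (F : Set (EuclideanSpace ℝ (Fin N)) → ℝ≥0∞)
    (hF : ∀ (R : EuclideanSpace ℝ (Fin N) ≃ₗᵢ[ℝ] EuclideanSpace ℝ (Fin N)) s, F (R '' s) = F s)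
    (x y : sphere (0 : EuclideanSpace ℝ (Fin N)) 1) (r : ℝ) :
    F (Subtype.val '' ball x r) = F (Subtype.val '' ball y r) := by
  have hxy : ‖(x : EuclideanSpace ℝ (Fin N))‖ = ‖(y : EuclideanSpace ℝ (Fin N))‖ := by simp
  set R := Submodule.reflection (ℝ ∙ ((x : EuclideanSpace ℝ (Fin N)) - y))ᗮ with hR
  have hRx : R x = y := Submodule.reflection_sub hxy
  rw [← hF R, Subtype.image_ball, Subtype.image_ball]
  congr 1
  ext z
  simp only [mem_image, mem_inter_iff, mem_ball, mem_ofPred_eq]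
  constructor
  · rintro ⟨w, ⟨h1, h2⟩, rfl⟩
    refine ⟨?_, by simpa using h2⟩
    rw [← hRx, R.dist_map]; exact h1
  · rintro ⟨h1, h2⟩
    refine ⟨R.symm z, ⟨?_, by simpa using h2⟩, by simp⟩
    rw [← R.dist_map, hRx]; simpa using h1

theorem alm_small_set {N : ℕ} (hN : 1 ≤ N) (h : ℝ) (h0 : 0 < h) (h1 : h < 1)
    (s : Set (sphere (0 : EuclideanSpace ℝ (Fin N)) 1)) (hs : MeasurableSet s)
    (hd : ediam s ≤ ENNReal.ofReal (h ^ 2)) :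
    (volume : Measure (EuclideanSpace ℝ (Fin N))).toSphere s * ENNReal.ofReal (1 - (1 - h) ^ N) ≤
      ENNReal.ofReal (N * (1 + h) ^ N * h) * ediam s ^ ((N : ℝ) - 1) := by
  rcases s.eq_empty_or_nonempty with rfl | ⟨x0, hx0⟩
  · simp
  set E := EuclideanSpace ℝ (Fin N)
  obtain ⟨m, rfl⟩ : ∃ m, N = m + 1 := ⟨N - 1, by omega⟩
  set T : Set E := Subtype.val '' s with hT
  set δ : ℝ := (ediam s).toReal with hδ
  have hfin : ediam s ≠ ∞ := ne_top_of_le_ne_top ENNReal.ofReal_ne_top hd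
  have hδ' : ediam s = ENNReal.ofReal δ := (ENNReal.ofReal_toReal hfin).symm
  have hδ0 : 0 ≤ δ := ENNReal.toReal_nonneg
  have hδh : δ ≤ h ^ 2 := by
    rw [hδ']  at hd
    exact (ENNReal.ofReal_le_ofReal_iff (by positivity)).1 hd
  have hdist : ∀ x ∈ T, ∀ y ∈ T, dist x y ≤ δ := by
    rintro _ ⟨x, hx, rfl⟩ _ ⟨y, hy, rfl⟩
    have := edist_le_ediam_of_mem hx hy
    rw [hδ', edist_dist] at this
    exact (ENNReal.ofReal_le_ofReal_iff hδ0).1 this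
  have hT1 : ∀ x ∈ T, ‖x‖ = 1 := by
    rintro _ ⟨x, hx, rfl⟩; simp
  set A : Set E := Ico (1 - h) 1 • T with hA
  -- volume of the shell
  have hshell : (volume (Ioo (0:ℝ) 1 • T)) * ENNReal.ofReal (1 - (1 - h) ^ (m+1)) ≤ volume A := by
    have hsub : Ioo (0:ℝ) 1 • T ⊆ ((1 - h) • (Ioo (0:ℝ) 1 • T)) ∪ A := by
      rintro _ ⟨t, ht, x, hx, rfl⟩
      by_cases htt : t < 1 - h
      · left
        refine ⟨(t / (1 - h)) • x, ⟨t / (1-h), ⟨div_pos ht.1 (by linarith), ?_⟩, x, hx, rfl⟩, ?_⟩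
        · rw [div_lt_one (by linarith)]; exact htt
        · simp only [smul_smul]; rw [mul_div_cancel₀ _ (by linarith)]
      · right
        exact ⟨t, ⟨not_lt.1 htt, ht.2⟩, x, hx, rfl⟩
    have hfinV : volume (Ioo (0:ℝ) 1 • T) ≠ ∞ := by
      refine ne_top_of_le_ne_top (measure_ball_lt_top (x := (0:E)) (r := 1)).ne (measure_mono ?_)
      rintro _ ⟨t, ht, x, hx, rfl⟩
      simp only [mem_ball_zero_iff, norm_smul, hT1 x hx, Real.norm_eq_abs, abs_of_pos ht.1, mul_one]
      exact ht.2
    have hle := (measure_mono hsub).trans (measure_union_le (μ := (volume : Measure E)) _ _)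
    rw [Measure.addHaar_smul_of_nonneg _ (by linarith), finrank_euclideanSpace_fin] at hle
    rw [ENNReal.ofReal_sub _ (by have : 0 < 1 - h := by linarith
                                 positivity), ENNReal.mul_sub (fun _ _ => hfinV), ENNReal.ofReal_one, mul_one,
      tsub_le_iff_right]
    refine hle.trans_eq ?_
    ring
  -- rotate
  set e : E := EuclideanSpace.single (Fin.last m) 1 with he
  have hxe : ‖(x0 : E)‖ = ‖e‖ := by
    rw [he]; exact Eq.trans (by simp) (PiLp.norm_single 2 (fun _ => ℝ) (Fin.last m) (1:ℝ)).symm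
  set R := Submodule.reflection (ℝ ∙ ((x0 : E) - e))ᗮ with hR
  have hRx : R x0 = e := Submodule.reflection_sub hxe
  have hx0T : (x0 : E) ∈ T := ⟨x0, hx0, rfl⟩
  have hvolA : volume A = volume ((WithLp.ofLp : E → (Fin (m+1) → ℝ)) '' (R '' A)) := by
    have e1 : volume (R '' A) = volume A := by
      rw [LinearIsometryEquiv.image_eq_preimage_symm]
      exact R.symm.measurePreserving.measure_preimage_equiv (f := R.symm.toMeasurableEquiv) A
    have e2 := (EuclideanSpace.volume_preserving_symm_measurableEquiv_toLp (Fin (m+1))).symm.measure_preimage_equiv (R '' A)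
    rw [← e1, ← e2]
    congr 1
    ext z
    simp only [mem_preimage, mem_image (f := WithLp.ofLp)]
    constructor
    · intro hz; exact ⟨_, hz, by simp⟩
    · rintro ⟨w, hw, rfl⟩; simpa using hw
  have hcoord : ∀ (z : E) i, |z i| ≤ ‖z‖ := fun z i => by
    simpa using PiLp.norm_apply_le z i
  have hbox : volume A ≤ ENNReal.ofReal ((1 + h) * δ) ^ m * ENNReal.ofReal (h + δ) := by
    rw [hvolA]
    refine (Real.volume_pi_le_prod_diam _).trans ?_
    rw [Fin.prod_univ_castSucc]
    gcongr ?_ * ?_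
    · calc _ ≤ ∏ i : Fin m, ENNReal.ofReal ((1 + h) * δ) := by
            apply Finset.prod_le_prod'
            intro i _
            apply ediam_le
            rintro _ ⟨_, ⟨_, ⟨_, ⟨t, ht, x, hx, rfl⟩, rfl⟩, rfl⟩, rfl⟩ _ ⟨_, ⟨_, ⟨_, ⟨t', ht', y, hy, rfl⟩, rfl⟩, rfl⟩, rfl⟩
            rw [edist_dist]
            apply ENNReal.ofReal_le_ofReal
            simp only [Function.eval, map_smul, PiLp.smul_apply, smul_eq_mul, Real.dist_eq]
            have a1 : |R x i.castSucc - R y i.castSucc| ≤ δ := by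
              have := hcoord (R x - R y) i.castSucc
              rw [← map_sub, R.norm_map, ← dist_eq_norm] at this
              simpa using this.trans (hdist x hx y hy)
            have a2 : |R y i.castSucc| ≤ δ := by
              have := hcoord (R y - e) i.castSucc
              rw [← hRx, ← map_sub, R.norm_map, ← dist_eq_norm, map_sub, hRx] at this
              have hz : e i.castSucc = 0 := by
                simp [he, (Fin.castSucc_lt_last i).ne]
              have h3 := this.trans (hdist y hy x0 hx0T)
              rw [PiLp.sub_apply, hz, sub_zero] at h3
              exact h3
            have e3 : t * R x i.castSucc - t' * R y i.castSucc = t * (R x i.castSucc - R y i.castSucc) + (t - t') * R y i.castSucc := by ring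
            have ht0 : |t| ≤ 1 := by rw [abs_le]; constructor <;> linarith [ht.1, ht.2]
            have ht1 : |t - t'| ≤ h := by rw [abs_le]; constructor <;> linarith [ht.1, ht.2, ht'.1, ht'.2]
            rw [e3]
            calc _ ≤ |t * (R x i.castSucc - R y i.castSucc)| + |(t - t') * R y i.castSucc| := abs_add_le _ _
              _ ≤ 1 * δ + h * δ := by
                  rw [abs_mul, abs_mul]; gcongr
              _ = _ := by ring
        _ = _ := by simp
    · apply ediam_le
      have key : ∀ t ∈ Ico (1-h) 1, ∀ x ∈ T, 1 - h - δ ≤ t * R x (Fin.last m) ∧ t * R x (Fin.last m) ≤ 1 := by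
        intro t ht x hx
        have a2 : |R x (Fin.last m) - 1| ≤ δ := by
          have := hcoord (R x - e) (Fin.last m)
          rw [← hRx, ← map_sub, R.norm_map, ← dist_eq_norm, map_sub, hRx] at this
          have hz : e (Fin.last m) = 1 := by
            simp [he]
          have h3 := this.trans (hdist x hx x0 hx0T)
          rw [PiLp.sub_apply, hz] at h3
          exact h3
        have a3 : |R x (Fin.last m)| ≤ 1 := by
          have := hcoord (R x) (Fin.last m)
          rwa [R.norm_map, hT1 x hx] at this
        rw [abs_le] at a2 a3
        have hδ1 : δ ≤ 1 := by nlinarith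
        constructor
        · nlinarith [ht.1, ht.2]
        · nlinarith [ht.1, ht.2]
      rintro _ ⟨_, ⟨_, ⟨_, ⟨t, ht, x, hx, rfl⟩, rfl⟩, rfl⟩, rfl⟩ _ ⟨_, ⟨_, ⟨_, ⟨t', ht', y, hy, rfl⟩, rfl⟩, rfl⟩, rfl⟩
      rw [edist_dist]
      apply ENNReal.ofReal_le_ofReal
      simp only [Function.eval, map_smul, PiLp.smul_apply, smul_eq_mul, Real.dist_eq]
      have k1 := key t ht x hx
      have k2 := key t' ht' y hy
      rw [abs_le]; constructor <;> linarith
  rw [Measure.toSphere_apply' _ hs, finrank_euclideanSpace_fin, mul_assoc]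
  calc _ ≤ ((m+1 : ℕ) : ℝ≥0∞) * (ENNReal.ofReal ((1 + h) * δ) ^ m * ENNReal.ofReal (h + δ)) := by
        gcongr _ * ?_; exact hshell.trans hbox
    _ ≤ _ := by
        have : (((m+1 : ℕ) : ℝ) - 1) = (m : ℝ) := by push_cast; ring
        rw [this, ENNReal.rpow_natCast, hδ', ← ENNReal.ofReal_pow (by positivity), ← ENNReal.ofReal_pow (by positivity),
          ← ENNReal.ofReal_mul (by positivity), ← ENNReal.ofReal_mul (by positivity), ← ENNReal.ofReal_natCast,
          ← ENNReal.ofReal_mul (by positivity)]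
        apply ENNReal.ofReal_le_ofReal
        rw [mul_pow]
        calc _ ≤ ((m+1 : ℕ) : ℝ) * ((1 + h)^m * δ ^ m * (h + h^2)) := by gcongr
          _ = _ := by ring

theorem alm_toSphere_le {N : ℕ} (hN : 1 ≤ N) :
    (volume : Measure (EuclideanSpace ℝ (Fin N))).toSphere ≤ μH[(N : ℝ) - 1] := by
  set σ := (volume : Measure (EuclideanSpace ℝ (Fin N))).toSphere
  have step : ∀ h : ℝ, 0 < h → h < 1 →
      ENNReal.ofReal ((1 - (1 - h) ^ N) / (N * (1 + h) ^ N * h)) • σ ≤ μH[(N : ℝ) - 1] := by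
    intro h h0 h1
    have hNpos : (0 : ℝ) < N := by exact_mod_cast hN
    have hp : 0 < N * (1 + h) ^ N * h := by positivity
    refine Measure.le_hausdorffMeasure _ _ (ENNReal.ofReal (h ^ 2)) (by positivity) ?_
    intro s hs
    have := alm_small_set hN h h0 h1 (closure s) isClosed_closure.measurableSet (by rwa [ediam_closure])
    rw [ediam_closure] at this
    calc (ENNReal.ofReal ((1 - (1 - h) ^ N) / (N * (1 + h) ^ N * h)) • σ) s
        ≤ (ENNReal.ofReal ((1 - (1 - h) ^ N) / (N * (1 + h) ^ N * h)) • σ) (closure s) :=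
          measure_mono subset_closure
      _ = (σ (closure s) * ENNReal.ofReal (1 - (1 - h) ^ N)) / ENNReal.ofReal (N * (1 + h) ^ N * h) := by
          rw [Measure.smul_apply, smul_eq_mul, ENNReal.ofReal_div_of_pos hp, mul_comm, mul_div_assoc]
      _ ≤ _ := by
          apply ENNReal.div_le_of_le_mul'
          exact this
  have lim : Tendsto (fun h : ℝ => (1 - (1 - h) ^ N) / (N * (1 + h) ^ N * h)) (𝓝[>] 0) (𝓝 1) := by
    have hd : HasDerivAt (fun h : ℝ => 1 - (1 - h) ^ N) (N : ℝ) 0 := by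
      have := (((hasDerivAt_id (0:ℝ)).const_sub 1).pow N).const_sub 1
      simpa using this
    have hs := hd.tendsto_slope_zero_right
    have h2 : Tendsto (fun h : ℝ => N * (1 + h) ^ N) (𝓝[>] 0) (𝓝 (N : ℝ)) := by
      have : Continuous (fun h : ℝ => N * (1 + h) ^ N) := by fun_prop
      have := this.tendsto 0
      simp only [add_zero, one_pow, mul_one] at this
      exact this.mono_left nhdsWithin_le_nhds
    have hN0 : (N : ℝ) ≠ 0 := by positivity
    have := hs.div h2 hN0
    rw [div_self hN0] at this
    refine this.congr' ?_
    filter_upwards [self_mem_nhdsWithin] with h hh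
    have : h ≠ 0 := ne_of_gt hh
    simp only [zero_add, smul_eq_mul, sub_zero, one_pow, sub_self, Pi.div_apply]
    rw [inv_mul_eq_div, div_div, mul_comm h]
  intro s
  have l2 : Tendsto (fun h : ℝ => (ENNReal.ofReal ((1 - (1 - h) ^ N) / (N * (1 + h) ^ N * h)) • σ) s) (𝓝[>] 0) (𝓝 (σ s)) := by
    have := (ENNReal.tendsto_ofReal lim)
    rw [ENNReal.ofReal_one] at this
    have := ENNReal.Tendsto.mul_const (b := σ s) this (Or.inl one_ne_zero)
    simpa using this
  refine le_of_tendsto l2 ?_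
  filter_upwards [Ioo_mem_nhdsGT (zero_lt_one' ℝ)] with h hh
  exact step h hh.1 hh.2 s

theorem alm_hausdorff_eq {N : ℕ} (hN : 1 ≤ N)
    (hfin : μH[(N : ℝ) - 1] (univ : Set (sphere (0 : EuclideanSpace ℝ (Fin N)) 1)) ≠ ∞) :
    ∃ c : ℝ≥0, 1 ≤ c ∧ (μH[(N : ℝ) - 1] : Measure (sphere (0 : EuclideanSpace ℝ (Fin N)) 1)) =
      c • (volume : Measure (EuclideanSpace ℝ (Fin N))).toSphere := by
  have : Nontrivial (EuclideanSpace ℝ (Fin N)) := by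
    have : Nonempty (Fin N) := ⟨⟨0, hN⟩⟩
    infer_instance
  have hd : (0 : ℝ) ≤ (N : ℝ) - 1 := by
    have : (1 : ℝ) ≤ N := by exact_mod_cast hN
    linarith
  set σ := (volume : Measure (EuclideanSpace ℝ (Fin N))).toSphere with hσ
  set μ := (μH[(N : ℝ) - 1] : Measure (sphere (0 : EuclideanSpace ℝ (Fin N)) 1)) with hμ
  have : IsFiniteMeasure μ := ⟨lt_top_iff_ne_top.2 hfin⟩
  have hne : Nonempty (sphere (0 : EuclideanSpace ℝ (Fin N)) 1) :=
    (NormedSpace.sphere_nonempty.2 zero_le_one).to_subtype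
  obtain ⟨x0⟩ := id hne
  have hle : σ ≤ μ := alm_toSphere_le hN
  have hσ0 : σ univ ≠ 0 := by
    rw [Ne, Measure.measure_univ_eq_zero]; exact Measure.toSphere_ne_zero _
  have hσpos : ∀ r > 0, σ (ball x0 r) ≠ 0 := fun r hr =>
    (isOpen_ball.measure_pos σ ⟨x0, mem_ball_self hr⟩).ne'
  have hval : (0 : ℝ) ≤ (N : ℝ) - 1 := hd
  have im : ∀ s : Set (sphere (0 : EuclideanSpace ℝ (Fin N)) 1), μ s = μH[(N : ℝ) - 1] (Subtype.val '' s) :=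
    fun s => (isometry_subtype_coe.hausdorffMeasure_image (Or.inl hd) s).symm
  have c1 : 1 ≤ μ univ / σ univ := by
    rw [ENNReal.le_div_iff_mul_le (Or.inl hσ0) (Or.inl (by finiteness)), one_mul]
    exact hle univ
  have c2 : μ univ / σ univ ≠ ∞ := ENNReal.div_ne_top hfin hσ0
  refine ⟨(μ univ / σ univ).toNNReal, ?_, ?_⟩
  · rw [← ENNReal.coe_le_coe, ENNReal.coe_toNNReal c2]; exact c1
  · refine unif_eq μ σ (fun r => μ (ball x0 r)) (fun r => σ (ball x0 r)) ?_ ?_ ?_ hσpos _ ?_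
    · intro x r hr
      rw [im, im]
      exact cap_eq _ (fun R s => R.toIsometryEquiv.hausdorffMeasure_image _ s) x x0 r
    · intro x r hr
      rw [hσ, Measure.toSphere_apply' _ measurableSet_ball, Measure.toSphere_apply' _ measurableSet_ball]
      refine cap_eq (fun s => _ * volume (Ioo (0:ℝ) 1 • s)) (fun R s => ?_) x x0 r
      congr 1
      have : Ioo (0:ℝ) 1 • (R '' s) = R '' (Ioo (0:ℝ) 1 • s) := by
        ext z
        constructor
        · rintro ⟨t, ht, _, ⟨x, hx, rfl⟩, rfl⟩
          exact ⟨t • x, ⟨t, ht, x, hx, rfl⟩, by simp⟩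
        · rintro ⟨_, ⟨t, ht, x, hx, rfl⟩, rfl⟩
          exact ⟨t, ht, _, ⟨x, hx, rfl⟩, by simp⟩
      rw [this, LinearIsometryEquiv.image_eq_preimage_symm]
      exact R.symm.measurePreserving.measure_preimage_equiv (f := R.symm.toMeasurableEquiv) _
    · intro r hr h0
      exact hσpos r hr (le_antisymm (h0 ▸ hle _) zero_le)
    · rw [ENNReal.coe_toNNReal c2, ENNReal.div_mul_cancel hσ0 (by finiteness)]

/-- Integral over the sphere of radius `r`, in Hausdorff measure, by scaling. -/
theorem alm_sphere_scale {N : ℕ} (hN : 1 ≤ N) (f : EuclideanSpace ℝ (Fin N) → ℝ) (r : ℝ) (hr : 0 < r) :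
    ∫ x in sphere (0 : EuclideanSpace ℝ (Fin N)) r, f x ∂(μH[(N : ℝ) - 1]) =
      r ^ (N - 1) * ∫ ω : sphere (0 : EuclideanSpace ℝ (Fin N)) 1, f (r • (ω : EuclideanSpace ℝ (Fin N))) ∂(μH[(N : ℝ) - 1]) := by
  have hd : (0 : ℝ) ≤ (N : ℝ) - 1 := by
    have : (1 : ℝ) ≤ N := by exact_mod_cast hN
    linarith
  have e1 : ∫ ω : sphere (0 : EuclideanSpace ℝ (Fin N)) 1, f (r • (ω : EuclideanSpace ℝ (Fin N))) ∂(μH[(N : ℝ) - 1])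
      = ∫ x in sphere (0 : EuclideanSpace ℝ (Fin N)) 1, f (r • x) ∂(μH[(N : ℝ) - 1]) := by
    have h := isometry_subtype_coe (s := sphere (0 : EuclideanSpace ℝ (Fin N)) 1).map_hausdorffMeasure (d := (N:ℝ)-1) (Or.inl hd)
    rw [Subtype.range_coe] at h
    rw [← h, (MeasurableEmbedding.subtype_coe isClosed_sphere.measurableSet).integral_map]
  let M : EuclideanSpace ℝ (Fin N) ≃ₜ EuclideanSpace ℝ (Fin N) := Homeomorph.smulOfNeZero r hr.ne'
  have hmap : Measure.map M ((μH[(N : ℝ) - 1] : Measure (EuclideanSpace ℝ (Fin N))).restrict (sphere 0 1))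
      = ENNReal.ofReal ((r ^ (N - 1))⁻¹) • (μH[(N : ℝ) - 1] : Measure (EuclideanSpace ℝ (Fin N))).restrict (sphere 0 r) := by
    ext s hs
    rw [Measure.map_apply M.measurable hs, Measure.restrict_apply (M.measurable hs), Measure.smul_apply,
      Measure.restrict_apply hs]
    have hset : s ∩ sphere 0 r = r • (M ⁻¹' s ∩ sphere (0 : EuclideanSpace ℝ (Fin N)) 1) := by
      ext z
      rw [mem_smul_set_iff_inv_smul_mem₀ hr.ne']
      have : M (r⁻¹ • z) = z := by
        change r • r⁻¹ • z = z
        rw [smul_inv_smul₀ hr.ne']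
      simp only [mem_inter_iff, mem_preimage, this, mem_sphere_zero_iff_norm, norm_smul, norm_inv, Real.norm_eq_abs, abs_of_pos hr]
      rw [inv_mul_eq_one₀ hr.ne', eq_comm (a := r)]
    rw [hset, Measure.hausdorffMeasure_smul₀ hd hr.ne']
    have hn : ‖r‖₊ ^ ((N:ℝ) - 1) = Real.toNNReal (r ^ (N-1)) := by
      have e : ((N:ℝ) - 1) = ((N - 1 : ℕ) : ℝ) := by push_cast [hN]; ring
      rw [e, NNReal.rpow_natCast, Real.toNNReal_pow hr.le]
      congr 1
      rw [Real.toNNReal_eq_nnnorm_of_nonneg hr.le]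
    rw [hn, ENNReal.smul_def, smul_eq_mul, smul_eq_mul, ← mul_assoc]
    change _ = ENNReal.ofReal _ * ENNReal.ofReal _ * _
    rw [← ENNReal.ofReal_mul (by positivity), inv_mul_cancel₀ (by positivity), ENNReal.ofReal_one, one_mul]
  have e2 : ∫ x in sphere (0 : EuclideanSpace ℝ (Fin N)) 1, f (r • x) ∂(μH[(N : ℝ) - 1])
      = (r ^ (N-1))⁻¹ * ∫ x in sphere (0 : EuclideanSpace ℝ (Fin N)) r, f x ∂(μH[(N : ℝ) - 1]) := by
    have := M.measurableEmbedding.integral_map (μ := (μH[(N : ℝ) - 1] : Measure (EuclideanSpace ℝ (Fin N))).restrict (sphere 0 1)) f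
    rw [hmap, integral_smul_measure, ENNReal.toReal_ofReal (by positivity)] at this
    rw [smul_eq_mul] at this
    rw [this]; rfl
  rw [e1, e2, ← mul_assoc, mul_inv_cancel₀ (by positivity), one_mul]


/-- Spherical integral `∫_{S} f(tω) dσ(ω)`. -/
noncomputable def almI {N : ℕ} (f : EuclideanSpace ℝ (Fin N) → ℝ) (t : ℝ) : ℝ :=
  ∫ ω : sphere (0 : EuclideanSpace ℝ (Fin N)) 1, f (t • (ω : EuclideanSpace ℝ (Fin N)))
    ∂(volume : Measure (EuclideanSpace ℝ (Fin N))).toSphere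

theorem alm_polar {N : ℕ} (hN : 1 ≤ N) (f : EuclideanSpace ℝ (Fin N) → ℝ) (hf : Integrable f) :
    ∫ x, f x = ∫ t in Ioi (0:ℝ), t ^ (N - 1) * almI f t := by
  have : Nontrivial (EuclideanSpace ℝ (Fin N)) := by
    have : Nonempty (Fin N) := ⟨⟨0, hN⟩⟩
    infer_instance
  set μ := (volume : Measure (EuclideanSpace ℝ (Fin N)))
  have mp := μ.measurePreserving_homeomorphUnitSphereProd
  have hdim : Module.finrank ℝ (EuclideanSpace ℝ (Fin N)) = N := finrank_euclideanSpace_fin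
  let F : sphere (0:(EuclideanSpace ℝ (Fin N))) 1 × Ioi (0:ℝ) → ℝ := fun p => f (p.2.1 • p.1.1)
  have hF : ∀ x : ({0}ᶜ : Set (EuclideanSpace ℝ (Fin N))), F (homeomorphUnitSphereProd (EuclideanSpace ℝ (Fin N)) x) = f x := by
    intro x
    have hx : ‖x.1‖ ≠ 0 := norm_ne_zero_iff.2 x.2
    simp [F, smul_smul, mul_inv_cancel₀ hx]
  have hInt : Integrable F (μ.toSphere.prod (.volumeIoiPow (Module.finrank ℝ (EuclideanSpace ℝ (Fin N)) - 1))) := by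
    rw [← mp.integrable_comp_emb (Homeomorph.measurableEmbedding _)]
    have : F ∘ homeomorphUnitSphereProd (EuclideanSpace ℝ (Fin N)) = f ∘ Subtype.val := funext hF
    rw [this]
    rw [← integrableOn_iff_comap_subtypeVal (measurableSet_singleton _).compl]
    exact hf.integrableOn
  calc ∫ x, f x = ∫ x : ({(0)}ᶜ : Set (EuclideanSpace ℝ (Fin N))), f x ∂(μ.comap (↑)) := by
        rw [integral_subtype_comap (measurableSet_singleton _).compl f,
          restrict_compl_singleton]
    _ = ∫ p, F p ∂μ.toSphere.prod (.volumeIoiPow (Module.finrank ℝ (EuclideanSpace ℝ (Fin N)) - 1)) := by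
        rw [← mp.integral_comp (Homeomorph.measurableEmbedding _) F]
        exact integral_congr_ae (.of_forall fun x => (hF x).symm)
    _ = ∫ t : Ioi (0:ℝ), almI f t ∂.volumeIoiPow (Module.finrank ℝ (EuclideanSpace ℝ (Fin N)) - 1) := integral_prod_symm _ hInt
    _ = _ := by
        rw [hdim]
        simp only [Measure.volumeIoiPow, ENNReal.ofReal]
        rw [integral_withDensity_eq_integral_smul, 
          integral_subtype_comap measurableSet_Ioi fun a ↦ Real.toNNReal (a ^ (N - 1)) • almI f a,
          setIntegral_congr_fun measurableSet_Ioi fun x hx ↦ ?_]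
        · rw [NNReal.smul_def, Real.coe_toNNReal _ (pow_nonneg hx.out.le _), smul_eq_mul]
        · exact (measurable_subtype_coe.pow_const _).real_toNNReal

theorem almI_continuous {N : ℕ} (f : EuclideanSpace ℝ (Fin N) → ℝ) (hf : Continuous f) :
    Continuous (almI f) := by
  unfold almI
  have := continuous_parametric_integral_of_continuous (μ := (volume : Measure (EuclideanSpace ℝ (Fin N))).toSphere)
    (f := fun (t : ℝ) (ω : sphere (0 : EuclideanSpace ℝ (Fin N)) 1) => f (t • (ω : EuclideanSpace ℝ (Fin N))))
    (by simp only [Function.uncurry_def]; fun_prop) (s := univ) isCompact_univ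
  simpa using this

theorem alm_polar_ball {N : ℕ} (hN : 1 ≤ N) (f : EuclideanSpace ℝ (Fin N) → ℝ) (hf : Continuous f)
    (r : ℝ) (hr : 0 < r) :
    ∫ x in ball (0 : EuclideanSpace ℝ (Fin N)) r, f x = ∫ t in (0:ℝ)..r, t ^ (N - 1) * almI f t := by
  have hi : Integrable ((ball (0 : EuclideanSpace ℝ (Fin N)) r).indicator f) := by
    rw [integrable_indicator_iff measurableSet_ball]
    exact (hf.continuousOn.integrableOn_compact (isCompact_closedBall 0 r)).mono_set ball_subset_closedBall
  rw [← integral_indicator measurableSet_ball, alm_polar hN _ hi, intervalIntegral.integral_of_le hr.le,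
    ← integral_Ioc_eq_integral_Ioo.symm]
  rw [← integral_indicator measurableSet_Ioo, ← integral_indicator measurableSet_Ioi]
  congr 1
  ext t
  by_cases ht : 0 < t
  · rw [indicator_of_mem (mem_Ioi.2 ht)]
    by_cases htr : t < r
    · rw [indicator_of_mem (mem_Ioo.2 ⟨ht, htr⟩)]
      congr 1
      unfold almI
      apply integral_congr_ae (.of_forall fun ω => ?_)
      beta_reduce
      rw [indicator_of_mem]
      simpa [norm_smul, abs_of_pos ht] using htr
    · rw [indicator_of_notMem (fun h => htr h.2)]
      unfold almI
      convert mul_zero _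
      apply integral_eq_zero_of_ae (.of_forall fun ω => ?_)
      beta_reduce
      rw [indicator_of_notMem]; · rfl
      simpa [norm_smul, abs_of_pos ht] using htr
  · rw [indicator_of_notMem (show t ∉ Ioi (0:ℝ) from ht), indicator_of_notMem (fun h => ht h.1)]

/-- partial derivative -/
noncomputable def almD {N : ℕ} (i : Fin N) (f : EuclideanSpace ℝ (Fin N) → ℝ)
    (x : EuclideanSpace ℝ (Fin N)) : ℝ := fderiv ℝ f x (EuclideanSpace.single i 1)

theorem almI_add {N : ℕ} (f g : EuclideanSpace ℝ (Fin N) → ℝ) (hf : Continuous f) (hg : Continuous g) (t : ℝ) :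
    almI (fun x => f x + g x) t = almI f t + almI g t := by
  unfold almI
  apply integral_add
  · exact Continuous.integrable_of_hasCompactSupport (by fun_prop) (HasCompactSupport.of_compactSpace _)
  · exact Continuous.integrable_of_hasCompactSupport (by fun_prop) (HasCompactSupport.of_compactSpace _)

/-- weak form -/
theorem alm_weak {N : ℕ} (hN : 1 ≤ N) (X : Fin N → EuclideanSpace ℝ (Fin N) → ℝ)
    (hX : ∀ i, ContDiff ℝ 1 (X i)) (ψ : ℝ → ℝ) (hψ : ContDiff ℝ 1 ψ) (hc : HasCompactSupport ψ)
    (hsupp : tsupport ψ ⊆ Ioi 0) :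
    ∫ t in Ioi (0:ℝ), ψ t * (t ^ (N-1) * almI (fun x => ∑ i, X i x * (‖x‖⁻¹ * x i)) t) =
    ∫ t in Ioi (0:ℝ), ψ t * (∫ s in (0:ℝ)..t, s ^ (N-1) * almI (fun x => ∑ i, almD i (X i) x) s) := by
  -- bounds for the support
  obtain ⟨M, hM0, hM⟩ : ∃ M : ℝ, 0 < M ∧ ∀ t, M ≤ t → ψ t = 0 := by
    obtain ⟨R, hR⟩ := hc.isCompact.bddAbove
    refine ⟨max (R+1) 1, by positivity, fun t ht => image_eq_zero_of_notMem_tsupport fun h => ?_⟩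
    have := hR h
    have := (le_max_left (R+1) 1).trans ht
    linarith
  obtain ⟨ε, hε0, hε⟩ : ∃ ε : ℝ, 0 < ε ∧ ∀ t, t < ε → ψ t = 0 := by
    have h0 : (0:ℝ) ∈ (tsupport ψ)ᶜ := fun h => lt_irrefl (0:ℝ) (mem_Ioi.1 (hsupp h))
    obtain ⟨ε, he, hb⟩ := Metric.isOpen_iff.1 (isClosed_tsupport ψ).isOpen_compl 0 h0
    refine ⟨ε, he, fun t ht => ?_⟩
    by_cases h : 0 < t
    · exact image_eq_zero_of_notMem_tsupport (hb (by simpa [abs_of_pos h] using ht))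
    · exact image_eq_zero_of_notMem_tsupport fun h' => h (hsupp h')
  let φ : ℝ → ℝ := fun t => ∫ s in t..M, ψ s
  have hφd : ∀ t, HasDerivAt φ (-ψ t) t := fun t =>
    intervalIntegral.integral_hasDerivAt_left (hψ.continuous.intervalIntegrable _ _)
      (hψ.continuous.stronglyMeasurableAtFilter _ _) hψ.continuous.continuousAt
  have hφ1 : ContDiff ℝ 1 φ := by
    rw [contDiff_one_iff_deriv]
    refine ⟨fun t => (hφd t).differentiableAt, ?_⟩
    have : deriv φ = fun t => -ψ t := funext fun t => (hφd t).deriv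
    rw [this]; exact hψ.continuous.neg
  have hφM : ∀ t, M ≤ t → φ t = 0 := by
    intro t ht
    simp only [φ]
    rw [intervalIntegral.integral_congr (g := fun _ => 0), intervalIntegral.integral_zero]
    intro s hs
    rw [uIcc_of_ge ht] at hs
    exact hM s hs.1
  have hφε : ∀ t, t < ε → φ t = φ 0 := by
    intro t ht
    simp only [φ]
    rw [← intervalIntegral.integral_add_adjacent_intervals (b := 0) (hψ.continuous.intervalIntegrable _ _) (hψ.continuous.intervalIntegrable _ _)]
    rw [add_eq_right]
    rw [intervalIntegral.integral_congr (g := fun _ => 0), intervalIntegral.integral_zero]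
    intro s hs
    rw [mem_uIcc] at hs
    apply hε
    rcases hs with hs | hs <;> linarith
  let F : (EuclideanSpace ℝ (Fin N)) → ℝ := fun x => φ ‖x‖
  have hF0 : F =ᶠ[𝓝 0] fun _ => φ 0 := by
    filter_upwards [ball_mem_nhds (0:(EuclideanSpace ℝ (Fin N))) hε0] with x hx
    exact hφε _ (by simpa using hx)
  have hFc : ContDiff ℝ 1 F := by
    rw [contDiff_iff_contDiffAt]
    intro x
    by_cases hx : x = 0
    · subst hx
      exact contDiffAt_const.congr_of_eventuallyEq hF0
    · exact hφ1.contDiffAt.comp x (contDiffAt_norm ℝ hx)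
  have hFD : ∀ i x, almD i F x = - (ψ ‖x‖ * (‖x‖⁻¹ * x i)) := by
    intro i x
    unfold almD
    by_cases hx : x = 0
    · subst hx
      rw [hF0.fderiv_eq]; simp
    · have h1 : HasFDerivAt (fun y : (EuclideanSpace ℝ (Fin N)) => ‖y‖) (‖x‖⁻¹ • (innerSL ℝ x)) x := by
        have hd : HasStrictFDerivAt (fun y : (EuclideanSpace ℝ (Fin N)) => ‖y‖ ^ 2) _ x := hasStrictFDerivAt_norm_sq x
        have h2 := hd.hasFDerivAt.sqrt (by simpa using hx)
        simp only [Real.sqrt_sq (norm_nonneg _)] at h2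
        have hnx : ‖x‖ ≠ 0 := norm_ne_zero_iff.2 hx
        have e : ‖x‖⁻¹ • (innerSL ℝ x) = (1 / (2 * ‖x‖)) • (2 • (innerSL ℝ x)) := by
          rw [← Nat.cast_smul_eq_nsmul ℝ, smul_smul]
          congr 1
          field_simp
          norm_num
        rw [e]
        exact h2
      have := (hφd ‖x‖).comp_hasFDerivAt x h1
      rw [show F = φ ∘ (fun y => ‖y‖) from rfl, this.fderiv]
      simp [EuclideanSpace.inner_single_right]
      
  have hFs : HasCompactSupport F := by
    refine HasCompactSupport.intro (isCompact_closedBall (0:(EuclideanSpace ℝ (Fin N))) M) fun x hx => ?_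
    apply hφM
    simp at hx; exact hx.le
  have hFs' : ∀ i, HasCompactSupport (fun x => almD i F x) := fun i => hFs.fderiv_apply (𝕜 := ℝ) _
  have cD : ∀ i, Continuous (fun x => almD i F x) := fun i =>
    (hFc.continuous_fderiv one_ne_zero).clm_apply continuous_const
  have cX : ∀ i j, Continuous (fun x => almD i (X j) x) := fun i j =>
    ((hX j).continuous_fderiv one_ne_zero).clm_apply continuous_const
  have ibp : ∀ i, ∫ x, F x * almD i (X i) x = ∫ x, ψ ‖x‖ * (X i x * (‖x‖⁻¹ * x i)) := by
    intro i
    have := integral_mul_fderiv_eq_neg_fderiv_mul_of_integrable (𝕜 := ℝ) (f := F) (g := X i) (μ := volume) (v := EuclideanSpace.single i 1)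
      ?_ ?_ ?_ (fun x _ => hFc.differentiable one_ne_zero x) (fun x _ => (hX i).differentiable one_ne_zero x)
    · change ∫ x, F x * almD i (X i) x = - ∫ x, almD i F x * X i x at this
      rw [this, ← integral_neg]
      congr 1; ext x; rw [hFD]; ring
    · exact ((cD i).mul (hX i).continuous).integrable_of_hasCompactSupport ((hFs' i).mul_right)
    · exact (hFc.continuous.mul (cX i i)).integrable_of_hasCompactSupport hFs.mul_right
    · exact (hFc.continuous.mul (hX i).continuous).integrable_of_hasCompactSupport hFs.mul_right
  have i1 : ∀ i, Integrable (fun x => F x * almD i (X i) x) := fun i =>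
    (hFc.continuous.mul (cX i i)).integrable_of_hasCompactSupport hFs.mul_right
  have i2 : ∀ i, Integrable (fun x => ψ ‖x‖ * (X i x * (‖x‖⁻¹ * x i))) := fun i => by
    have := ((cD i).mul (hX i).continuous).integrable_of_hasCompactSupport (μ := volume) ((hFs' i).mul_right)
    refine this.neg.congr (.of_forall fun x => ?_)
    simp only [Pi.neg_apply, Pi.mul_apply, hFD]; ring
  have total : ∫ x, F x * (∑ i, almD i (X i) x) = ∫ x, ψ ‖x‖ * (∑ i, X i x * (‖x‖⁻¹ * x i)) := by
    simp only [Finset.mul_sum]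
    rw [integral_finsetSum _ (fun i _ => i1 i), integral_finsetSum _ (fun i _ => i2 i)]
    exact Finset.sum_congr rfl fun i _ => ibp i
  have j1 : Integrable (fun x => F x * (∑ i, almD i (X i) x)) := by
    simp only [Finset.mul_sum]; exact integrable_finsetSum _ fun i _ => i1 i
  have j2 : Integrable (fun x => ψ ‖x‖ * (∑ i, X i x * (‖x‖⁻¹ * x i))) := by
    simp only [Finset.mul_sum]; exact integrable_finsetSum _ fun i _ => i2 i
  rw [alm_polar hN _ j1, alm_polar hN _ j2] at total
  have nrm : ∀ t ∈ Ioi (0:ℝ), ∀ ω : sphere (0:(EuclideanSpace ℝ (Fin N))) 1, ‖t • (ω:(EuclideanSpace ℝ (Fin N)))‖ = t := by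
    intro t ht ω
    rw [norm_smul, norm_eq_of_mem_sphere, mul_one, Real.norm_eq_abs, abs_of_pos ht]
  have r1 : ∀ t ∈ Ioi (0:ℝ), t ^ (N-1) * almI (fun x => F x * (∑ i, almD i (X i) x)) t =
      φ t * (t ^ (N-1) * almI (fun x => (∑ i, almD i (X i) x)) t) := by
    intro t ht
    rw [mul_left_comm]; congr 1
    unfold almI
    rw [← integral_const_mul]
    congr 1; ext ω
    simp only [F, nrm t ht]
  have r2 : ∀ t ∈ Ioi (0:ℝ), t ^ (N-1) * almI (fun x => ψ ‖x‖ * (∑ i, X i x * (‖x‖⁻¹ * x i))) t =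
      ψ t * (t ^ (N-1) * almI (fun x => (∑ i, X i x * (‖x‖⁻¹ * x i))) t) := by
    intro t ht
    rw [mul_left_comm]; congr 1
    unfold almI
    rw [← integral_const_mul]
    congr 1; ext ω
    simp only [nrm t ht]
  rw [setIntegral_congr_fun measurableSet_Ioi r1, setIntegral_congr_fun measurableSet_Ioi r2] at total
  rw [← total]
  -- one dimensional integration by parts
  set a : ℝ → ℝ := fun t => t ^ (N-1) * almI (fun x => (∑ i, almD i (X i) x)) t with ha
  have ca : Continuous a := by
    have := almI_continuous (fun x => (∑ i, almD i (X i) x)) (continuous_finsetSum _ fun i _ => cX i i)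
    fun_prop
  have cut : ∀ g : ℝ → ℝ, (∀ t, M ≤ t → g t = 0) → ∫ t in Ioi (0:ℝ), g t = ∫ t in (0:ℝ)..M, g t := by
    intro g hg
    rw [intervalIntegral.integral_of_le hM0.le]
    refine setIntegral_eq_of_subset_of_forall_sdiff_eq_zero measurableSet_Ioi Ioc_subset_Ioi_self ?_
    rintro t ⟨h1, h2⟩
    exact hg t (le_of_lt (not_le.1 fun h => h2 ⟨h1, h⟩))
  rw [cut _ (fun t ht => by rw [hφM t ht, zero_mul]), cut _ (fun t ht => by rw [hM t ht, zero_mul])]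
  have hA : ∀ t, HasDerivAt (fun t => ∫ s in (0:ℝ)..t, a s) (a t) t := fun t =>
    intervalIntegral.integral_hasDerivAt_right (ca.intervalIntegrable _ _)
      (ca.stronglyMeasurableAtFilter _ _) ca.continuousAt
  have := intervalIntegral.integral_mul_deriv_eq_deriv_mul (a := 0) (b := M) (u := φ) (v := fun t => ∫ s in (0:ℝ)..t, a s)
    (u' := fun t => - ψ t) (v' := a) (fun t _ => hφd t) (fun t _ => hA t) (hψ.continuous.neg.intervalIntegrable _ _)
    (ca.intervalIntegrable _ _)
  rw [this, hφM M le_rfl]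
  simp

theorem alm_div {N : ℕ} (hN : 1 ≤ N) (X : Fin N → EuclideanSpace ℝ (Fin N) → ℝ)
    (hX : ∀ i, ContDiff ℝ 1 (X i)) (r : ℝ) (hr : 0 < r) :
    ∫ x in ball (0 : EuclideanSpace ℝ (Fin N)) r, (∑ i, almD i (X i) x) =
      r ^ (N-1) * almI (fun x => ∑ i, X i x * (‖x‖⁻¹ * x i)) r := by
  have cX : ∀ i j, Continuous (fun x => almD i (X j) x) := fun i j =>
    ((hX j).continuous_fderiv one_ne_zero).clm_apply continuous_const
  have cdiv : Continuous (fun x => ∑ i, almD i (X i) x) := continuous_finsetSum _ fun i _ => cX i i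
  rw [alm_polar_ball hN _ cdiv r hr]
  set a : ℝ → ℝ := fun t => t ^ (N-1) * almI (fun x => (∑ i, almD i (X i) x)) t with ha
  have ca : Continuous a := by
    have := almI_continuous _ cdiv
    fun_prop
  have cA : Continuous (fun t => ∫ s in (0:ℝ)..t, a s) :=
    intervalIntegral.continuous_primitive (fun _ _ => ca.intervalIntegrable _ _) 0
  set p : ℝ → ℝ := fun t => t ^ (N-1) * almI (fun x => ∑ i, X i x * (‖x‖⁻¹ * x i)) t with hp
  have hp' : ∀ t ∈ Ioi (0:ℝ), p t = t ^ (N-1) * ∫ ω : sphere (0 : EuclideanSpace ℝ (Fin N)) 1,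
      ∑ i, X i (t • (ω : EuclideanSpace ℝ (Fin N))) * (ω : EuclideanSpace ℝ (Fin N)) i
      ∂(volume : Measure (EuclideanSpace ℝ (Fin N))).toSphere := by
    intro t ht
    simp only [hp, almI]
    congr 2
    ext ω
    apply Finset.sum_congr rfl
    intro i _
    rw [norm_smul, norm_eq_of_mem_sphere, mul_one, Real.norm_eq_abs, abs_of_pos ht]
    simp only [PiLp.smul_apply, smul_eq_mul]
    rw [inv_mul_cancel_left₀ (ne_of_gt ht)]
  have cp : ContinuousOn p (Ioi 0) := by
    refine ContinuousOn.congr ?_ hp'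
    apply Continuous.continuousOn
    have := continuous_parametric_integral_of_continuous (μ := (volume : Measure (EuclideanSpace ℝ (Fin N))).toSphere)
      (f := fun (t : ℝ) (ω : sphere (0 : EuclideanSpace ℝ (Fin N)) 1) =>
        ∑ i, X i (t • (ω : EuclideanSpace ℝ (Fin N))) * (ω : EuclideanSpace ℝ (Fin N)) i)
      (by
        simp only [Function.uncurry_def]
        refine continuous_finsetSum _ fun i _ => ?_
        have := (hX i).continuous
        fun_prop) (s := univ) isCompact_univ
    simp only [Measure.restrict_univ] at this
    fun_prop
  have cq : ContinuousOn (fun t => p t - ∫ s in (0:ℝ)..t, a s) (Ioi 0) := cp.sub cA.continuousOn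
  have hae := isOpen_Ioi.ae_eq_zero_of_integral_contDiff_smul_eq_zero (U := Ioi (0:ℝ)) (μ := volume)
    (f := fun t => p t - ∫ s in (0:ℝ)..t, a s) (cq.locallyIntegrableOn measurableSet_Ioi) ?_
  · have h2 : (fun t => p t - ∫ s in (0:ℝ)..t, a s) =ᵐ[volume.restrict (Ioi 0)] fun _ => 0 := by
      rw [EventuallyEq, ae_restrict_iff' measurableSet_Ioi]
      exact hae
    have := Measure.eqOn_open_of_ae_eq h2 isOpen_Ioi cq continuousOn_const
    have := this hr
    simp only at this
    linarith
  · intro g hg hgc hgs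
    have hw := alm_weak hN X hX g (hg.of_le (by exact_mod_cast le_top)) hgc hgs
    have hgi : ∀ q : ℝ → ℝ, ContinuousOn q (Ioi 0) → Integrable (fun t => g t * q t) := by
      intro q hq
      have hcc : Continuous (fun t => g t * q t) := by
        rw [continuous_iff_continuousAt]
        intro t
        by_cases ht : t ∈ tsupport g
        · exact hg.continuous.continuousAt.mul (hq.continuousAt (isOpen_Ioi.mem_nhds (hgs ht)))
        · have : (fun t => g t * q t) =ᶠ[𝓝 t] fun _ => 0 := by
            filter_upwards [(isClosed_tsupport g).isOpen_compl.mem_nhds ht] with s hs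
            rw [image_eq_zero_of_notMem_tsupport hs, zero_mul]
          exact continuousAt_const.congr this.symm
      exact hcc.integrable_of_hasCompactSupport hgc.mul_right
    have hz : ∀ q : ℝ → ℝ, ∫ t, g t * q t = ∫ t in Ioi (0:ℝ), g t * q t := by
      intro q
      rw [setIntegral_eq_integral_of_forall_compl_eq_zero]
      intro t ht
      rw [image_eq_zero_of_notMem_tsupport (fun h => ht (hgs h)), zero_mul]
    simp only [smul_eq_mul, mul_sub]
    rw [integral_sub (hgi p cp) (hgi _ cA.continuousOn), hz, hz, hw, sub_self]


theorem alm_div' {N : ℕ} (hN : 1 ≤ N) (X : Fin N → EuclideanSpace ℝ (Fin N) → ℝ)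
    (hX : ∀ i, ContDiff ℝ 1 (X i)) (r : ℝ) (hr : 0 < r) :
    ∫ x in ball (0 : EuclideanSpace ℝ (Fin N)) r, (∑ i, almD i (X i) x) =
      r ^ (N-1) * ∫ ω : sphere (0 : EuclideanSpace ℝ (Fin N)) 1,
      ∑ i, X i (r • (ω : EuclideanSpace ℝ (Fin N))) * (ω : EuclideanSpace ℝ (Fin N)) i
      ∂(volume : Measure (EuclideanSpace ℝ (Fin N))).toSphere := by
  rw [alm_div hN X hX r hr]
  simp only [almI]
  congr 2
  ext ω
  apply Finset.sum_congr rfl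
  intro i _
  rw [norm_smul, norm_eq_of_mem_sphere, mul_one, Real.norm_eq_abs, abs_of_pos hr]
  simp only [PiLp.smul_apply, smul_eq_mul]
  rw [inv_mul_cancel_left₀ (ne_of_gt hr)]

section calc_rules
variable {N : ℕ} {f g : EuclideanSpace ℝ (Fin N) → ℝ} (i : Fin N) (x : EuclideanSpace ℝ (Fin N))

theorem almD_add (hf : ContDiff ℝ 1 f) (hg : ContDiff ℝ 1 g) :
    almD i (fun y => f y + g y) x = almD i f x + almD i g x := by
  unfold almD
  rw [fderiv_fun_add (hf.differentiable one_ne_zero x) (hg.differentiable one_ne_zero x)]; rfl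

theorem almD_sub (hf : ContDiff ℝ 1 f) (hg : ContDiff ℝ 1 g) :
    almD i (fun y => f y - g y) x = almD i f x - almD i g x := by
  unfold almD
  rw [fderiv_fun_sub (hf.differentiable one_ne_zero x) (hg.differentiable one_ne_zero x)]; rfl

theorem almD_mul (hf : ContDiff ℝ 1 f) (hg : ContDiff ℝ 1 g) :
    almD i (fun y => f y * g y) x = almD i f x * g x + f x * almD i g x := by
  unfold almD
  rw [fderiv_fun_mul (hf.differentiable one_ne_zero x) (hg.differentiable one_ne_zero x)]
  simp; ring

theorem almD_const_mul (c : ℝ) (hf : ContDiff ℝ 1 f) :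
    almD i (fun y => c * f y) x = c * almD i f x := by
  unfold almD
  rw [fderiv_const_mul (hf.differentiable one_ne_zero x)]; rfl

theorem almD_sum (F : Fin N → EuclideanSpace ℝ (Fin N) → ℝ) (hF : ∀ j, ContDiff ℝ 1 (F j)) :
    almD i (fun y => ∑ j, F j y) x = ∑ j, almD i (F j) x := by
  unfold almD
  rw [fderiv_fun_sum (fun j _ => (hF j).differentiable one_ne_zero x)]; simp

theorem alm_contDiff_coord (j : Fin N) : ContDiff ℝ 1 (fun y : EuclideanSpace ℝ (Fin N) => y j) := by
  fun_prop

theorem almD_coord (j : Fin N) :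
    almD i (fun y : EuclideanSpace ℝ (Fin N) => y j) x = if j = i then 1 else 0 := by
  unfold almD
  have : HasFDerivAt (fun y : EuclideanSpace ℝ (Fin N) => y j) (EuclideanSpace.proj j : EuclideanSpace ℝ (Fin N) →L[ℝ] ℝ) x :=
    (EuclideanSpace.proj j : EuclideanSpace ℝ (Fin N) →L[ℝ] ℝ).hasFDerivAt
  rw [this.fderiv]
  simp [Pi.single_apply]

theorem alm_contDiff_D (hf : ContDiff ℝ 2 f) : ContDiff ℝ 1 (almD i f) := by
  unfold almD
  exact (hf.fderiv_right (m := 1) (by norm_num)).clm_apply contDiff_const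

theorem almD_symm (hf : ContDiff ℝ 2 f) (j : Fin N) :
    almD i (almD j f) x = almD j (almD i f) x := by
  have hd : DifferentiableAt ℝ (fderiv ℝ f) x :=
    (hf.fderiv_right (m := 1) (by norm_num)).differentiable one_ne_zero x
  have key : ∀ a b : EuclideanSpace ℝ (Fin N), fderiv ℝ (fun y => fderiv ℝ f y a) x b = fderiv ℝ (fderiv ℝ f) x b a := by
    intro a b
    rw [fderiv_clm_apply hd (differentiableAt_const a)]
    simp
  have hs : IsSymmSndFDerivAt ℝ f x := hf.contDiffAt.isSymmSndFDerivAt (by simp)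
  unfold almD
  rw [key, key]
  exact hs _ _

theorem alm_grad (hf : ContDiff ℝ 2 f) : ‖gradient f x‖ ^ 2 = ∑ i, almD i f x * almD i f x := by
  rw [EuclideanSpace.norm_sq_eq]
  apply Finset.sum_congr rfl
  intro i _
  have : gradient f x i = almD i f x := by
    unfold almD
    have hd := (hf.differentiable two_ne_zero x).hasGradientAt
    rw [hd.hasFDerivAt.fderiv]
    rw [InnerProductSpace.toDual_apply_apply, EuclideanSpace.inner_single_right]
    simp
  rw [this, Real.norm_eq_abs, sq_abs, sq]

end calc_rules

/-- energy density -/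
noncomputable def almE {N : ℕ} (u v : EuclideanSpace ℝ (Fin N) → ℝ) (x : EuclideanSpace ℝ (Fin N)) : ℝ :=
  (∑ j, almD j u x * almD j u x) + (∑ j, almD j v x * almD j v x) + (u x * u x) * (v x * v x)

theorem almE_contDiff {N : ℕ} {u v : EuclideanSpace ℝ (Fin N) → ℝ} (hu : ContDiff ℝ 2 u) (hv : ContDiff ℝ 2 v) :
    ContDiff ℝ 1 (almE u v) := by
  have h1 := fun j : Fin N => alm_contDiff_D j hu
  have h2 := fun j : Fin N => alm_contDiff_D j hv
  have h3 : ContDiff ℝ 1 u := hu.of_le (by norm_num)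
  have h4 : ContDiff ℝ 1 v := hv.of_le (by norm_num)
  unfold almE
  refine ((ContDiff.sum fun j _ => (h1 j).mul (h1 j)).add (ContDiff.sum fun j _ => (h2 j).mul (h2 j))).add ?_
  exact (h3.mul h3).mul (h4.mul h4)

theorem alm_div1 {N : ℕ} {u v : EuclideanSpace ℝ (Fin N) → ℝ} (hu : ContDiff ℝ 2 u) (hv : ContDiff ℝ 2 v)
    (hequ : ∀ x, ∑ i, almD i (almD i u) x = u x * (v x) ^ 2)
    (heqv : ∀ x, ∑ i, almD i (almD i v) x = v x * (u x) ^ 2) (x : EuclideanSpace ℝ (Fin N)) :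
    ∑ i, almD i (fun y => u y * almD i u y + v y * almD i v y) x = almE u v x + (u x * u x) * (v x * v x) := by
  have h1 := fun j : Fin N => alm_contDiff_D j hu
  have h2 := fun j : Fin N => alm_contDiff_D j hv
  have h3 : ContDiff ℝ 1 u := hu.of_le (by norm_num)
  have h4 : ContDiff ℝ 1 v := hv.of_le (by norm_num)
  have : ∀ i, almD i (fun y => u y * almD i u y + v y * almD i v y) x =
      almD i u x * almD i u x + u x * almD i (almD i u) x + (almD i v x * almD i v x + v x * almD i (almD i v) x) := by
    intro i
    rw [almD_add i x (h3.mul (h1 i)) (h4.mul (h2 i)), almD_mul i x h3 (h1 i), almD_mul i x h4 (h2 i)]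
  simp only [this, Finset.sum_add_distrib, ← Finset.mul_sum, hequ, heqv, almE]
  ring

theorem alm_div2_aux {N : ℕ} {u : EuclideanSpace ℝ (Fin N) → ℝ} (hu : ContDiff ℝ 2 u) (x : EuclideanSpace ℝ (Fin N)) (i : Fin N) :
    almD i (fun y => ∑ j, y j * almD j u y) x = almD i u x + ∑ j, x j * almD j (almD i u) x := by
  have h1 := fun j : Fin N => alm_contDiff_D j hu
  rw [almD_sum i x _ (fun j => (alm_contDiff_coord j).mul (h1 j))]
  have : ∀ j, almD i (fun y : EuclideanSpace ℝ (Fin N) => y j * almD j u y) x = (if j = i then 1 else 0) * almD j u x + x j * almD j (almD i u) x := by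
    intro j
    rw [almD_mul i x (alm_contDiff_coord j) (h1 j), almD_coord, almD_symm i x hu j]
  simp only [this, Finset.sum_add_distrib]
  simp

theorem alm_div2 {N : ℕ} {u v : EuclideanSpace ℝ (Fin N) → ℝ} (hu : ContDiff ℝ 2 u) (hv : ContDiff ℝ 2 v)
    (hequ : ∀ x, ∑ i, almD i (almD i u) x = u x * (v x) ^ 2)
    (heqv : ∀ x, ∑ i, almD i (almD i v) x = v x * (u x) ^ 2) (x : EuclideanSpace ℝ (Fin N)) :
    ∑ i, almD i (fun y => almE u v y * y i - (2 * ((∑ j, y j * almD j u y) * almD i u y)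
      + 2 * ((∑ j, y j * almD j v y) * almD i v y))) x =
      ((N : ℝ) - 2) * almE u v x + 2 * ((u x * u x) * (v x * v x)) := by
  have h1 := fun j : Fin N => alm_contDiff_D j hu
  have h2 := fun j : Fin N => alm_contDiff_D j hv
  have h3 : ContDiff ℝ 1 u := hu.of_le (by norm_num)
  have h4 : ContDiff ℝ 1 v := hv.of_le (by norm_num)
  have h5 := almE_contDiff hu hv
  have hxu : ContDiff ℝ 1 (fun y : EuclideanSpace ℝ (Fin N) => ∑ j, y j * almD j u y) :=
    ContDiff.sum fun j _ => (alm_contDiff_coord j).mul (h1 j)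
  have hxv : ContDiff ℝ 1 (fun y : EuclideanSpace ℝ (Fin N) => ∑ j, y j * almD j v y) :=
    ContDiff.sum fun j _ => (alm_contDiff_coord j).mul (h2 j)
  have hEd : ∀ i, almD i (almE u v) x = 2 * (∑ j, almD j u x * almD i (almD j u) x) +
      2 * (∑ j, almD j v x * almD i (almD j v) x) + 2 * (u x * (v x)^2) * almD i u x + 2 * (v x * (u x)^2) * almD i v x := by
    intro i
    have e : almE u v = fun x => (∑ j, almD j u x * almD j u x) + (∑ j, almD j v x * almD j v x) + (u x * u x) * (v x * v x) := rfl
    rw [e, almD_add i x ((ContDiff.sum fun j _ => (h1 j).mul (h1 j)).add (ContDiff.sum fun j _ => (h2 j).mul (h2 j))) ((h3.mul h3).mul (h4.mul h4)),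
      almD_add i x (ContDiff.sum fun j _ => (h1 j).mul (h1 j)) (ContDiff.sum fun j _ => (h2 j).mul (h2 j)),
      almD_sum i x _ (fun j => (h1 j).mul (h1 j)), almD_sum i x _ (fun j => (h2 j).mul (h2 j)),
      almD_mul i x (h3.mul h3) (h4.mul h4), almD_mul i x h3 h3, almD_mul i x h4 h4]
    have a1 : ∀ j, almD i (fun y => almD j u y * almD j u y) x = 2 * (almD j u x * almD i (almD j u) x) := by
      intro j; rw [almD_mul i x (h1 j) (h1 j)]; ring
    have a2 : ∀ j, almD i (fun y => almD j v y * almD j v y) x = 2 * (almD j v x * almD i (almD j v) x) := by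
      intro j; rw [almD_mul i x (h2 j) (h2 j)]; ring
    simp only [a1, a2, ← Finset.mul_sum]
    ring
  have main : ∀ i, almD i (fun y => almE u v y * y i - (2 * ((∑ j, y j * almD j u y) * almD i u y)
      + 2 * ((∑ j, y j * almD j v y) * almD i v y))) x =
      almE u v x + x i * (2 * (∑ j, almD j u x * almD i (almD j u) x) +
      2 * (∑ j, almD j v x * almD i (almD j v) x)) + 2 * (u x * (v x)^2) * (x i * almD i u x) + 2 * (v x * (u x)^2) * (x i * almD i v x)
      - 2 * (almD i u x * almD i u x) - 2 * (almD i v x * almD i v x)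
      - 2 * (∑ j, x j * almD j (almD i u) x) * almD i u x - 2 * (∑ j, x j * almD j (almD i v) x) * almD i v x
      - 2 * (∑ j, x j * almD j u x) * almD i (almD i u) x - 2 * (∑ j, x j * almD j v x) * almD i (almD i v) x := by
    intro i
    rw [almD_sub i x (h5.mul (alm_contDiff_coord i)) ((contDiff_const.mul (hxu.mul (h1 i))).add (contDiff_const.mul (hxv.mul (h2 i)))),
      almD_add i x (contDiff_const.mul (hxu.mul (h1 i))) (contDiff_const.mul (hxv.mul (h2 i))),
      almD_const_mul i x 2 (hxu.mul (h1 i)), almD_const_mul i x 2 (hxv.mul (h2 i)),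
      almD_mul i x h5 (alm_contDiff_coord i), almD_mul i x hxu (h1 i), almD_mul i x hxv (h2 i), hEd, almD_coord,
      alm_div2_aux hu, alm_div2_aux hv, if_pos rfl]
    ring
  have sw : ∀ w : EuclideanSpace ℝ (Fin N) → ℝ, ∑ i, x i * (∑ j, almD j w x * almD i (almD j w) x) =
      ∑ i, (∑ j, x j * almD j (almD i w) x) * almD i w x := by
    intro w
    simp only [Finset.mul_sum, Finset.sum_mul]
    rw [Finset.sum_comm]
    refine Finset.sum_congr rfl fun i _ => Finset.sum_congr rfl fun j _ => ?_
    ring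
  have t1 : ∀ (A B : Fin N → ℝ), ∑ i, x i * (2 * A i + 2 * B i) = 2 * (∑ i, x i * A i) + 2 * (∑ i, x i * B i) := by
    intro A B
    simp only [Finset.mul_sum, ← Finset.sum_add_distrib]
    exact Finset.sum_congr rfl fun i _ => by ring
  have t2 : ∀ (A B : Fin N → ℝ), ∑ i, 2 * A i * B i = 2 * ∑ i, A i * B i := by
    intro A B
    simp only [Finset.mul_sum]
    exact Finset.sum_congr rfl fun i _ => by ring
  simp only [main, Finset.sum_add_distrib, Finset.sum_sub_distrib]
  have s1 : ∑ i, 2 * (∑ j, x j * almD j (almD i u) x) * almD i u x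
      = 2 * ∑ i, (∑ j, x j * almD j (almD i u) x) * almD i u x := t2 _ _
  have s2 : ∑ i, 2 * (∑ j, x j * almD j (almD i v) x) * almD i v x
      = 2 * ∑ i, (∑ j, x j * almD j (almD i v) x) * almD i v x := t2 _ _
  rw [t1, sw u, sw v, s1, s2, ← Finset.mul_sum, ← Finset.mul_sum, ← Finset.mul_sum, ← Finset.mul_sum,
    ← Finset.mul_sum, ← Finset.mul_sum, hequ, heqv]
  simp only [Finset.sum_const, Finset.card_univ, Fintype.card_fin, nsmul_eq_mul]
  unfold almE
  ring


theorem alm_ode_mono (N : ℕ) (hN : 1 ≤ N) (H E P I K Q : ℝ → ℝ)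
    (hH : ∀ r, 0 < r → HasDerivAt H (2 * K r / r) r)
    (hE : ∀ r, 0 < r → HasDerivAt E (r ^ (N-1) * I r) r)
    (h1 : ∀ r, 0 < r → r * (E r + P r) = r ^ (N-1) * K r)
    (h2 : ∀ r, 0 < r → r * (((N:ℝ) - 2) * E r + 2 * P r) = r ^ (N-1) * (r ^ 2 * I r - 2 * Q r))
    (hCS : ∀ r, 0 < r → K r ^ 2 ≤ H r * Q r)
    (hHpos : ∀ r, 0 < r → 0 < H r) (hEn : ∀ r, 0 < r → 0 ≤ E r) (hPn : ∀ r, 0 < r → 0 ≤ P r) :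
    MonotoneOn (fun r => r * E r / (r ^ (N-1) * H r)) (Ioi 0) := by
  have hder : ∀ r, 0 < r → ∃ d, 0 ≤ d ∧ HasDerivAt (fun r => r * E r / (r ^ (N-1) * H r)) d r := by
    intro r hr
    have hs : 0 < r ^ (N-1) := pow_pos hr _
    have dnum : HasDerivAt (fun r => r * E r) (1 * E r + r * (r ^ (N-1) * I r)) r :=
      (hasDerivAt_id r).mul (hE r hr)
    have dden : HasDerivAt (fun r => r ^ (N-1) * H r)
        ((((N-1 : ℕ) : ℝ) * r ^ (N-1-1)) * H r + r ^ (N-1) * (2 * K r / r)) r :=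
      (hasDerivAt_pow (N-1) r).mul (hH r hr)
    refine ⟨_, ?_, dnum.div dden (mul_pos hs (hHpos r hr)).ne'⟩
    apply div_nonneg _ (sq_nonneg _)
    have hp : ((N-1 : ℕ) : ℝ) * r ^ (N-1-1) * r = ((N:ℝ) - 1) * r ^ (N-1) := by
      rcases Nat.exists_eq_add_of_le hN with ⟨k, rfl⟩
      rcases k with _ | k
      · simp
      · have : 1 + (k+1) - 1 = k + 1 := by omega
        rw [this]; simp [pow_succ]; ring
    have hKn : 0 ≤ K r := by
      have : 0 ≤ r ^ (N-1) * K r := by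
        rw [← h1 r hr]; exact mul_nonneg hr.le (add_nonneg (hEn r hr) (hPn r hr))
      exact nonneg_of_mul_nonneg_right this hs
    set s := r ^ (N-1)
    set p := ((N-1 : ℕ) : ℝ) * r ^ (N-1-1)
    have e1 := h1 r hr
    have e2 := h2 r hr
    have hk : 2 * K r / r * r = 2 * K r := by field_simp
    set k := 2 * K r / r
    have key : r * ((1 * E r + r * (s * I r)) * (s * H r) - r * E r * (p * H r + s * k)) =
        2 * s * (r * P r * H r + s * (H r * Q r) - r * E r * K r) := by
      have : r * r * s * I r = r * (((N:ℝ) - 2) * E r + 2 * P r) + 2 * s * Q r := by rw [e2]; ring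
      calc _ = s * H r * (r * E r + r * r * s * I r) - r * E r * ((p * r) * H r + s * (k * r)) := by ring
        _ = _ := by rw [this, hp, hk]; ring
    have key2 : 0 ≤ r * ((1 * E r + r * (s * I r)) * (s * H r) - r * E r * (p * H r + s * k)) := by
      rw [key]
      have c1 : s * K r ^ 2 ≤ s * (H r * Q r) := mul_le_mul_of_nonneg_left (hCS r hr) hs.le
      have c2 : s * K r ^ 2 = r * (E r + P r) * K r := by rw [e1]; ring
      have c3 : 0 ≤ r * P r * H r := mul_nonneg (mul_nonneg hr.le (hPn r hr)) (hHpos r hr).le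
      have c4 : 0 ≤ r * P r * K r := mul_nonneg (mul_nonneg hr.le (hPn r hr)) hKn
      apply mul_nonneg (by positivity)
      nlinarith
    exact nonneg_of_mul_nonneg_right key2 hr
  apply monotoneOn_of_deriv_nonneg (convex_Ioi 0)
  · intro r hr
    obtain ⟨d, _, hd⟩ := hder r hr
    exact hd.continuousAt.continuousWithinAt
  · intro r hr
    rw [interior_Ioi] at hr
    obtain ⟨d, _, hd⟩ := hder r hr
    exact hd.differentiableAt.differentiableWithinAt
  · intro r hr
    rw [interior_Ioi] at hr
    obtain ⟨d, h0, hd⟩ := hder r hr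
    rw [hd.deriv]; exact h0

theorem alm_ode_bound (N : ℕ) (H E P K : ℝ → ℝ)
    (hH : ∀ r, 0 < r → HasDerivAt H (2 * K r / r) r)
    (h1 : ∀ r, 0 < r → r * (E r + P r) = r ^ (N-1) * K r)
    (hHpos : ∀ r, 0 < r → 0 < H r) (hPn : ∀ r, 0 < r → 0 ≤ P r)
    (hm : MonotoneOn (fun r => r * E r / (r ^ (N-1) * H r)) (Ioi 0))
    (A α : ℝ) (hα : 1 ≤ α) (hA : 0 ≤ A) (hg : ∀ r, 0 < r → H r ≤ A * (1 + r) ^ (2 * α)) :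
    ∀ r, 0 < r → r * E r / (r ^ (N-1) * H r) ≤ α := by
  intro r₀ hr₀
  by_contra hlt
  push Not at hlt
  set m := r₀ * E r₀ / (r₀ ^ (N-1) * H r₀) with hmdef
  have hmono : MonotoneOn (fun r => H r * r ^ (-(2*m))) (Ici r₀) := by
    have hder : ∀ r, r₀ ≤ r → HasDerivAt (fun r => H r * r ^ (-(2*m)))
        (2 * K r / r * r ^ (-(2*m)) + H r * ((-(2*m)) * r ^ (-(2*m) - 1))) r := by
      intro r hr
      have hr' : 0 < r := hr₀.trans_le hr
      exact (hH r hr').mul (Real.hasDerivAt_rpow_const (Or.inl hr'.ne'))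
    apply monotoneOn_of_deriv_nonneg (convex_Ici r₀)
    · intro r hr
      exact (hder r hr).continuousAt.continuousWithinAt
    · intro r hr
      exact (hder r (interior_subset hr)).differentiableAt.differentiableWithinAt
    · intro r hr
      have hr2 : r₀ ≤ r := interior_subset hr
      have hr' : 0 < r := hr₀.trans_le hr2
      rw [(hder r hr2).deriv, Real.rpow_sub_one hr'.ne']
      have hs : 0 < r ^ (N-1) := pow_pos hr' _
      have hle : m ≤ r * E r / (r ^ (N-1) * H r) := hm hr₀ hr' hr2
      rw [le_div_iff₀ (mul_pos hs (hHpos r hr'))] at hle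
      have hK : m * H r ≤ K r := by
        have e := h1 r hr'
        have : 0 ≤ r * P r := mul_nonneg hr'.le (hPn r hr')
        have : r ^ (N-1) * (m * H r) ≤ r ^ (N-1) * K r := by rw [← e]; nlinarith
        exact le_of_mul_le_mul_left this hs
      have : 2 * K r / r * r ^ (-(2*m)) + H r * ((-(2*m)) * (r ^ (-(2*m)) / r)) =
          (2 * (K r - m * H r)) / r * r ^ (-(2*m)) := by ring
      rw [this]
      have : 0 ≤ K r - m * H r := by linarith
      positivity
  set c := H r₀ * r₀ ^ (-(2*m)) with hc
  have hcpos : 0 < c := mul_pos (hHpos r₀ hr₀) (Real.rpow_pos_of_pos hr₀ _)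
  have htend : Tendsto (fun r : ℝ => r ^ (2*(m-α))) atTop atTop := tendsto_rpow_atTop (by linarith)
  obtain ⟨r, hr1, hr2⟩ := ((htend.eventually_gt_atTop (A * 2 ^ (2*α) / c)).and
    (eventually_ge_atTop (max 1 r₀))).exists
  have hr3 : 1 ≤ r := (le_max_left _ _).trans hr2
  have hr4 : r₀ ≤ r := (le_max_right _ _).trans hr2
  have hr' : 0 < r := by linarith
  have b1 : c ≤ H r * r ^ (-(2*m)) := hmono (mem_Ici.2 le_rfl) hr4 hr4
  have b2 : H r ≤ A * (2 ^ (2*α) * r ^ (2*α)) := by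
    refine (hg r hr').trans (mul_le_mul_of_nonneg_left ?_ hA)
    rw [← Real.mul_rpow (by norm_num) hr'.le]
    exact Real.rpow_le_rpow (by linarith) (by linarith) (by linarith)
  have b3 : c ≤ A * 2 ^ (2*α) * r ^ (-(2*(m-α))) := by
    refine b1.trans ((mul_le_mul_of_nonneg_right b2 (Real.rpow_pos_of_pos hr' _).le).trans_eq ?_)
    have : r ^ (-(2*(m-α))) = r ^ (2*α) * r ^ (-(2*m)) := by
      rw [← Real.rpow_add hr']; congr 1; ring
    rw [this]; ring
  rw [Real.rpow_neg hr'.le, ← div_eq_mul_inv, le_div_iff₀ (Real.rpow_pos_of_pos hr' _)] at b3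
  rw [div_lt_iff₀ hcpos] at hr1
  linarith [mul_comm c (r ^ (2*(m-α)))]

theorem alm_cs {Ω : Type*} [MeasurableSpace Ω] [TopologicalSpace Ω] [CompactSpace Ω] [OpensMeasurableSpace Ω]
    (μ : Measure Ω) [IsFiniteMeasure μ]
    (a b c d : Ω → ℝ) (ha : Continuous a) (hb : Continuous b) (hc : Continuous c) (hd : Continuous d) :
    (∫ x, (a x * c x + b x * d x) ∂μ) ^ 2 ≤ (∫ x, (a x * a x + b x * b x) ∂μ) * ∫ x, (c x * c x + d x * d x) ∂μ := by
  have int : ∀ f : Ω → ℝ, Continuous f → Integrable f μ := fun f hf =>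
    Continuous.integrable_of_hasCompactSupport hf (HasCompactSupport.of_compactSpace _)
  have i1 := int (fun x => a x * a x + b x * b x) (by fun_prop)
  have i2 := int (fun x => a x * c x + b x * d x) (by fun_prop)
  have i3 := int (fun x => c x * c x + d x * d x) (by fun_prop)
  have key : ∀ t : ℝ, 0 ≤ (∫ x, (a x * a x + b x * b x) ∂μ) * (t * t) +
      (2 * ∫ x, (a x * c x + b x * d x) ∂μ) * t + ∫ x, (c x * c x + d x * d x) ∂μ := by
    intro t
    have : (∫ x, (a x * a x + b x * b x) ∂μ) * (t * t) +
      (2 * ∫ x, (a x * c x + b x * d x) ∂μ) * t + ∫ x, (c x * c x + d x * d x) ∂μ =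
      ∫ x, ((a x * a x + b x * b x) * (t * t) + (a x * c x + b x * d x) * (2 * t) + (c x * c x + d x * d x)) ∂μ := by
      have i12 : Integrable (fun x => (a x * a x + b x * b x) * (t * t) + (a x * c x + b x * d x) * (2 * t)) μ :=
        (i1.mul_const _).add (i2.mul_const _)
      rw [integral_add i12 i3, integral_add (i1.mul_const _) (i2.mul_const _),
        integral_mul_const, integral_mul_const]
      ring
    rw [this]
    apply integral_nonneg
    intro x
    have : 0 ≤ (t * a x + c x) ^ 2 + (t * b x + d x) ^ 2 := by positivity
    simp only [Pi.zero_apply]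
    linarith
  have := discrim_le_zero key
  unfold discrim at this
  linarith

theorem almI_hasDerivAt {N : ℕ} (f : EuclideanSpace ℝ (Fin N) → ℝ) (hf : ContDiff ℝ 1 f) (r : ℝ) (hr : 0 < r) :
    HasDerivAt (almI f) (almI (fun x => fderiv ℝ f x x) r / r) r := by
  have hcd : Continuous (fderiv ℝ f) := hf.continuous_fderiv one_ne_zero
  have hcF' : Continuous (fun p : ℝ × sphere (0 : EuclideanSpace ℝ (Fin N)) 1 =>
      fderiv ℝ f (p.1 • (p.2 : EuclideanSpace ℝ (Fin N))) (p.2 : EuclideanSpace ℝ (Fin N))) := by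
    apply Continuous.clm_apply
    · exact hcd.comp (by fun_prop)
    · fun_prop
  obtain ⟨M, hM⟩ := (isCompact_Icc (a := r-1) (b := r+1)).prod (isCompact_univ (X := sphere (0 : EuclideanSpace ℝ (Fin N)) 1))
    |>.exists_bound_of_continuousOn hcF'.continuousOn
  have int : ∀ f : sphere (0 : EuclideanSpace ℝ (Fin N)) 1 → ℝ, Continuous f →
      Integrable f (volume : Measure (EuclideanSpace ℝ (Fin N))).toSphere := fun f hf =>
    Continuous.integrable_of_hasCompactSupport hf (HasCompactSupport.of_compactSpace _)
  have hcf := hf.continuous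
  have := hasDerivAt_integral_of_dominated_loc_of_deriv_le
    (μ := (volume : Measure (EuclideanSpace ℝ (Fin N))).toSphere)
    (F := fun t (ω : sphere (0 : EuclideanSpace ℝ (Fin N)) 1) => f (t • (ω : EuclideanSpace ℝ (Fin N))))
    (F' := fun t (ω : sphere (0 : EuclideanSpace ℝ (Fin N)) 1) =>
      fderiv ℝ f (t • (ω : EuclideanSpace ℝ (Fin N))) (ω : EuclideanSpace ℝ (Fin N)))
    (x₀ := r) (s := Icc (r-1) (r+1)) (bound := fun _ => M)
    (Icc_mem_nhds (by linarith) (by linarith))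
    (Eventually.of_forall fun t => (int _ (by fun_prop)).aestronglyMeasurable)
    (int _ (by fun_prop))
    ((int _ (hcF'.comp (by fun_prop : Continuous fun ω : sphere (0 : EuclideanSpace ℝ (Fin N)) 1 => (r, ω)))).aestronglyMeasurable)
    (Eventually.of_forall fun ω t ht => hM (t, ω) ⟨ht, mem_univ _⟩)
    (int _ continuous_const)
    (Eventually.of_forall fun ω t ht => by
      have h1 := (hf.differentiable one_ne_zero (t • (ω : EuclideanSpace ℝ (Fin N)))).hasFDerivAt
      have h2 : HasDerivAt (fun t : ℝ => t • (ω : EuclideanSpace ℝ (Fin N))) (ω : EuclideanSpace ℝ (Fin N)) t := by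
        simpa using (hasDerivAt_id t).smul_const (ω : EuclideanSpace ℝ (Fin N))
      exact h1.comp_hasDerivAt t h2)
  have e : almI (fun x => fderiv ℝ f x x) r / r = ∫ ω : sphere (0 : EuclideanSpace ℝ (Fin N)) 1,
      fderiv ℝ f (r • (ω : EuclideanSpace ℝ (Fin N))) (ω : EuclideanSpace ℝ (Fin N))
      ∂(volume : Measure (EuclideanSpace ℝ (Fin N))).toSphere := by
    unfold almI
    rw [div_eq_iff hr.ne', ← integral_mul_const]
    congr 1; ext ω
    beta_reduce
    rw [map_smul, smul_eq_mul, mul_comm]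
  rw [e]; exact this.2

theorem alm_fderiv_self {N : ℕ} (f : EuclideanSpace ℝ (Fin N) → ℝ) (x : EuclideanSpace ℝ (Fin N)) :
    fderiv ℝ f x x = ∑ j, x j * almD j f x := by
  unfold almD
  have h := congrArg (fderiv ℝ f x) ((EuclideanSpace.basisFun (Fin N) ℝ).sum_repr x)
  rw [← h]
  simp


theorem alm_core {N : ℕ} (hN : 1 ≤ N) (u v : EuclideanSpace ℝ (Fin N) → ℝ)
    (hu : ContDiff ℝ 2 u) (hv : ContDiff ℝ 2 v)
    (hequ : ∀ x, ∑ i, almD i (almD i u) x = u x * (v x) ^ 2)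
    (heqv : ∀ x, ∑ i, almD i (almD i v) x = v x * (u x) ^ 2)
    (hupos : ∀ x, 0 < u x) (hvpos : ∀ x, 0 < v x)
    (C α : ℝ) (hC : 0 < C) (hα : 1 ≤ α)
    (hgrowth : ∀ x, u x + v x ≤ C * (1 + ‖x‖) ^ α) :
    MonotoneOn (fun r => r * (∫ x in ball (0 : EuclideanSpace ℝ (Fin N)) r, almE u v x) /
      (r ^ (N-1) * almI (fun x => u x * u x + v x * v x) r)) (Ioi 0) ∧
    ∀ r, 0 < r → r * (∫ x in ball (0 : EuclideanSpace ℝ (Fin N)) r, almE u v x) /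
      (r ^ (N-1) * almI (fun x => u x * u x + v x * v x) r) ≤ α := by
  have hnt : Nontrivial (EuclideanSpace ℝ (Fin N)) := by
    have : Nonempty (Fin N) := ⟨⟨0, hN⟩⟩
    infer_instance
  have h1 := fun j : Fin N => alm_contDiff_D j hu
  have h2 := fun j : Fin N => alm_contDiff_D j hv
  have h3 : ContDiff ℝ 1 u := hu.of_le (by norm_num)
  have h4 : ContDiff ℝ 1 v := hv.of_le (by norm_num)
  have h5 := almE_contDiff hu hv
  set Ru : EuclideanSpace ℝ (Fin N) → ℝ := fun y => ∑ j, y j * almD j u y with hRu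
  set Rv : EuclideanSpace ℝ (Fin N) → ℝ := fun y => ∑ j, y j * almD j v y with hRv
  have hxu : ContDiff ℝ 1 Ru := ContDiff.sum fun j _ => (alm_contDiff_coord j).mul (h1 j)
  have hxv : ContDiff ℝ 1 Rv := ContDiff.sum fun j _ => (alm_contDiff_coord j).mul (h2 j)
  have c3 := h3.continuous
  have c4 := h4.continuous
  have c5 := h5.continuous
  have cu := hxu.continuous
  have cv := hxv.continuous
  have sint : ∀ f : sphere (0 : EuclideanSpace ℝ (Fin N)) 1 → ℝ, Continuous f →
      Integrable f (volume : Measure (EuclideanSpace ℝ (Fin N))).toSphere := fun f hf =>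
    Continuous.integrable_of_hasCompactSupport hf (HasCompactSupport.of_compactSpace _)
  have bint : ∀ (f : EuclideanSpace ℝ (Fin N) → ℝ) (r : ℝ), Continuous f → IntegrableOn f (ball 0 r) := fun f r hf =>
    (hf.continuousOn.integrableOn_compact (isCompact_closedBall 0 r)).mono_set ball_subset_closedBall
  set P : ℝ → ℝ := fun r => ∫ x in ball (0 : EuclideanSpace ℝ (Fin N)) r, (u x * u x) * (v x * v x) with hP
  set E : ℝ → ℝ := fun r => ∫ x in ball (0 : EuclideanSpace ℝ (Fin N)) r, almE u v x with hE
  set H : ℝ → ℝ := almI (fun x => u x * u x + v x * v x) with hH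
  set K : ℝ → ℝ := almI (fun x => u x * Ru x + v x * Rv x) with hK
  set Q : ℝ → ℝ := almI (fun x => Ru x * Ru x + Rv x * Rv x) with hQ
  -- the divergence theorem in the form used below
  have dv : ∀ (X : Fin N → EuclideanSpace ℝ (Fin N) → ℝ) (hX : ∀ i, ContDiff ℝ 1 (X i)) (r : ℝ) (hr : 0 < r),
      r * ∫ x in ball (0 : EuclideanSpace ℝ (Fin N)) r, (∑ i, almD i (X i) x) =
      r ^ (N-1) * almI (fun x => ∑ i, X i x * x i) r := by
    intro X hX r hr
    rw [alm_div' hN X hX r hr, mul_left_comm]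
    congr 1
    unfold almI
    rw [← integral_const_mul]
    congr 1; ext ω
    rw [Finset.mul_sum]
    refine Finset.sum_congr rfl fun i _ => ?_
    simp only [PiLp.smul_apply, smul_eq_mul]
    ring
  have hHd : ∀ r, 0 < r → HasDerivAt H (2 * K r / r) r := by
    intro r hr
    have hc : ContDiff ℝ 1 (fun x => u x * u x + v x * v x) := (h3.mul h3).add (h4.mul h4)
    have := almI_hasDerivAt _ hc r hr
    convert this using 2
    rw [hK]
    unfold almI
    rw [← integral_const_mul]
    congr 1; ext ω
    beta_reduce
    rw [alm_fderiv_self, hRu, hRv]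
    set x := r • (ω : EuclideanSpace ℝ (Fin N))
    have : ∀ j, almD j (fun x => u x * u x + v x * v x) x = 2 * (u x * almD j u x + v x * almD j v x) := by
      intro j
      rw [almD_add j x (h3.mul h3) (h4.mul h4), almD_mul j x h3 h3, almD_mul j x h4 h4]
      ring
    simp only [this, Finset.mul_sum, ← Finset.sum_add_distrib]
    exact Finset.sum_congr rfl fun i _ => by ring
  have hEd : ∀ r, 0 < r → HasDerivAt E (r ^ (N-1) * almI (almE u v) r) r := by
    intro r hr
    have hc : Continuous (fun t : ℝ => t ^ (N-1) * almI (almE u v) t) :=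
      (continuous_pow _).mul (almI_continuous _ c5)
    have := hc.integral_hasStrictDerivAt 0 r |>.hasDerivAt
    refine this.congr_of_eventuallyEq ?_
    filter_upwards [lt_mem_nhds hr] with t ht
    exact alm_polar_ball hN _ c5 t ht
  have hPn : ∀ r, 0 < r → 0 ≤ P r := by
    intro r _
    apply integral_nonneg
    intro x
    have := hupos x
    have := hvpos x
    simp only [Pi.zero_apply]
    positivity
  have hEn : ∀ r, 0 < r → 0 ≤ E r := by
    intro r _
    apply integral_nonneg
    intro x
    have := hupos x
    have := hvpos x
    simp only [Pi.zero_apply, almE]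
    have := Finset.sum_nonneg (s := Finset.univ) fun j _ => mul_self_nonneg (almD j u x)
    have := Finset.sum_nonneg (s := Finset.univ) fun j _ => mul_self_nonneg (almD j v x)
    positivity
  have hHpos : ∀ r, 0 < r → 0 < H r := by
    intro r _
    have hp : ∀ x, 0 < u x * u x + v x * v x := fun x =>
      add_pos (mul_pos (hupos x) (hupos x)) (mul_pos (hvpos x) (hvpos x))
    refine (integral_pos_iff_support_of_nonneg (fun ω => (hp _).le) (sint _ (by fun_prop))).2 ?_
    have : Function.support (fun ω : sphere (0 : EuclideanSpace ℝ (Fin N)) 1 =>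
        u (r • (ω : EuclideanSpace ℝ (Fin N))) * u (r • (ω : EuclideanSpace ℝ (Fin N))) +
        v (r • (ω : EuclideanSpace ℝ (Fin N))) * v (r • (ω : EuclideanSpace ℝ (Fin N)))) = univ :=
      eq_univ_of_forall fun ω => (hp _).ne'
    rw [this]
    exact Measure.measure_univ_pos.2 (Measure.toSphere_ne_zero _)
  have e1 : ∀ r, 0 < r → r * (E r + P r) = r ^ (N-1) * K r := by
    intro r hr
    have := dv (fun i y => u y * almD i u y + v y * almD i v y)
      (fun i => (h3.mul (h1 i)).add (h4.mul (h2 i))) r hr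
    simp only [alm_div1 hu hv hequ heqv] at this
    rw [integral_add (bint _ r c5) (bint _ r (by fun_prop))] at this
    rw [this, hK]
    congr 3; ext x
    rw [hRu, hRv]
    simp only [Finset.mul_sum, ← Finset.sum_add_distrib]
    exact Finset.sum_congr rfl fun i _ => by ring
  have e2 : ∀ r, 0 < r → r * (((N:ℝ) - 2) * E r + 2 * P r) = r ^ (N-1) * (r ^ 2 * almI (almE u v) r - 2 * Q r) := by
    intro r hr
    have := dv (fun i y => almE u v y * y i - (2 * ((∑ j, y j * almD j u y) * almD i u y)
      + 2 * ((∑ j, y j * almD j v y) * almD i v y)))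
      (fun i => (h5.mul (alm_contDiff_coord i)).sub ((contDiff_const.mul (hxu.mul (h1 i))).add
        (contDiff_const.mul (hxv.mul (h2 i))))) r hr
    simp only [alm_div2 hu hv hequ heqv] at this
    rw [integral_add ((bint _ r c5).const_mul _) ((bint _ r (by fun_prop)).const_mul _), integral_const_mul,
      integral_const_mul] at this
    rw [this, hQ]
    congr 1
    unfold almI
    rw [← integral_const_mul, ← integral_const_mul, ← integral_sub (sint _ (by fun_prop)) (sint _ (by fun_prop))]
    congr 1; ext ω
    beta_reduce
    have hx : ∑ i, (r • (ω : EuclideanSpace ℝ (Fin N))) i * (r • (ω : EuclideanSpace ℝ (Fin N))) i = r ^ 2 := by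
      have h := EuclideanSpace.real_norm_sq_eq (r • (ω : EuclideanSpace ℝ (Fin N)))
      rw [norm_smul, norm_eq_of_mem_sphere, mul_one, Real.norm_eq_abs, sq_abs] at h
      rw [h]
      exact Finset.sum_congr rfl fun i _ => by ring
    rw [← hx]
    set x := r • (ω : EuclideanSpace ℝ (Fin N))
    have a1 : Ru x * Ru x = ∑ i, Ru x * (x i * almD i u x) := by
      rw [← Finset.mul_sum]
    have a2 : Rv x * Rv x = ∑ i, Rv x * (x i * almD i v x) := by
      rw [← Finset.mul_sum]
    rw [a1, a2, ← Finset.sum_add_distrib, Finset.mul_sum, Finset.sum_mul, ← Finset.sum_sub_distrib]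
    exact Finset.sum_congr rfl fun i _ => by simp only [hRu, hRv]; ring
  have hCS : ∀ r, 0 < r → K r ^ 2 ≤ H r * Q r := by
    intro r hr
    exact alm_cs (volume : Measure (EuclideanSpace ℝ (Fin N))).toSphere
      (fun ω => u (r • (ω : EuclideanSpace ℝ (Fin N)))) (fun ω => v (r • (ω : EuclideanSpace ℝ (Fin N))))
      (fun ω => Ru (r • (ω : EuclideanSpace ℝ (Fin N)))) (fun ω => Rv (r • (ω : EuclideanSpace ℝ (Fin N))))
      (by fun_prop) (by fun_prop) (by fun_prop) (by fun_prop)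
  have hm := alm_ode_mono N hN H E P _ K Q hHd hEd e1 e2 hCS hHpos hEn hPn
  refine ⟨hm, ?_⟩
  set S := (volume : Measure (EuclideanSpace ℝ (Fin N))).toSphere.real univ
  refine alm_ode_bound N H E P K hHd e1 hHpos hPn hm (S * C ^ 2) α hα (by positivity) ?_
  intro r hr
  have : ∀ ω : sphere (0 : EuclideanSpace ℝ (Fin N)) 1, u (r • (ω : EuclideanSpace ℝ (Fin N))) * u (r • (ω : EuclideanSpace ℝ (Fin N)))
      + v (r • (ω : EuclideanSpace ℝ (Fin N))) * v (r • (ω : EuclideanSpace ℝ (Fin N))) ≤ C ^ 2 * (1 + r) ^ (2 * α) := by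
    intro ω
    have hg := hgrowth (r • (ω : EuclideanSpace ℝ (Fin N)))
    rw [norm_smul, norm_eq_of_mem_sphere, mul_one, Real.norm_eq_abs, abs_of_pos hr] at hg
    have p1 := hupos (r • (ω : EuclideanSpace ℝ (Fin N)))
    have p2 := hvpos (r • (ω : EuclideanSpace ℝ (Fin N)))
    have e : (1 + r) ^ (2 * α) = ((1 + r) ^ α) ^ 2 := by
      rw [mul_comm, Real.rpow_mul (by linarith)]; norm_num
    rw [e, ← mul_pow]
    have := pow_le_pow_left₀ (add_pos p1 p2).le hg 2
    nlinarith [mul_pos p1 p2]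
  have h := integral_mono (sint _ (by fun_prop)) (sint _ continuous_const) this
  rw [integral_const, smul_eq_mul] at h
  rw [mul_assoc]
  exact h


end almgren_helpers

/-- **Lemma 2.1.** For a solution of the system with algebraic growth
`u(x) + v(x) ≤ C (1 + |x|)^α`, the limit `𝒩(∞)` of the Almgren frequency function
exists and is at most `α`. -/
theorem almgren_limit_le_of_algebraic_growth
    (N : ℕ) (hN : 1 ≤ N) (u v : EuclideanSpace ℝ (Fin N) → ℝ)
    (hu : ContDiff ℝ 2 u) (hv : ContDiff ℝ 2 v)
    (hequ : ∀ x, lapl u x = u x * (v x) ^ 2)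
    (heqv : ∀ x, lapl v x = v x * (u x) ^ 2)
    (hupos : ∀ x, 0 < u x) (hvpos : ∀ x, 0 < v x)
    (C α : ℝ) (hC : 0 < C) (hα : 1 ≤ α)
    (hgrowth : ∀ x, u x + v x ≤ C * (1 + ‖x‖) ^ α) :
    ∃ L : ℝ, Tendsto (freq u v) atTop (nhds L) ∧ L ≤ α := by
  obtain ⟨hmono, hbd⟩ := alm_core hN u v hu hv hequ heqv hupos hvpos C α hC hα hgrowth
  set n : ℝ → ℝ := fun r => r * (∫ x in ball (0 : EuclideanSpace ℝ (Fin N)) r, almE u v x) /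
      (r ^ (N-1) * almI (fun x => u x * u x + v x * v x) r) with hn
  have hc3 := hu.continuous
  have hc4 := hv.continuous
  have hp : ∀ x, 0 < u x * u x + v x * v x := fun x =>
      add_pos (mul_pos (hupos x) (hupos x)) (mul_pos (hvpos x) (hvpos x))
  have hnn : ∀ r, 0 < r → 0 ≤ n r := by
    intro r hr
    have i1 : 0 ≤ ∫ x in ball (0 : EuclideanSpace ℝ (Fin N)) r, almE u v x := by
      apply integral_nonneg
      intro x
      have := hupos x
      have := hvpos x
      simp only [Pi.zero_apply, almE]
      have := Finset.sum_nonneg (s := Finset.univ) fun j _ => mul_self_nonneg (almD j u x)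
      have := Finset.sum_nonneg (s := Finset.univ) fun j _ => mul_self_nonneg (almD j v x)
      positivity
    have i2 : 0 ≤ almI (fun x => u x * u x + v x * v x) r := integral_nonneg fun ω => (hp _).le
    simp only [hn]
    positivity
  have hfreq : ∀ r, 0 < r → freq u v r = r * (∫ x in ball (0 : EuclideanSpace ℝ (Fin N)) r, almE u v x) /
      (r ^ (N-1) * ∫ ω : sphere (0 : EuclideanSpace ℝ (Fin N)) 1,
        (fun x => u x * u x + v x * v x) (r • (ω : EuclideanSpace ℝ (Fin N))) ∂(μH[(N : ℝ) - 1])) := by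
    intro r hr
    unfold freq
    rw [alm_sphere_scale hN (fun x => (u x) ^ 2 + (v x) ^ 2) r hr]
    have e1 : ∀ x, ‖gradient u x‖ ^ 2 + ‖gradient v x‖ ^ 2 + (u x) ^ 2 * (v x) ^ 2 = almE u v x := by
      intro x
      rw [alm_grad x hu, alm_grad x hv, almE]
      ring
    simp only [e1]
    simp only [sq]
  by_cases hfin : μH[(N:ℝ)-1] (Set.univ : Set (sphere (0 : EuclideanSpace ℝ (Fin N)) 1)) = ⊤
  · refine ⟨0, ?_, by linarith⟩
    apply tendsto_const_nhds.congr'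
    filter_upwards [eventually_gt_atTop 0] with r hr
    rw [hfreq r hr]
    suffices hz : ¬ Integrable (fun ω : sphere (0 : EuclideanSpace ℝ (Fin N)) 1 =>
        (fun x => u x * u x + v x * v x) (r • (ω : EuclideanSpace ℝ (Fin N)))) (μH[(N : ℝ) - 1]) by
      rw [integral_undef hz, mul_zero, div_zero]
    intro hInt
    have hnt : Nontrivial (EuclideanSpace ℝ (Fin N)) := by
      have : Nonempty (Fin N) := ⟨⟨0, hN⟩⟩
      infer_instance
    have hne : (Set.univ : Set (sphere (0 : EuclideanSpace ℝ (Fin N)) 1)).Nonempty := by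
      obtain ⟨x, hx⟩ := (NormedSpace.sphere_nonempty (x := (0 : EuclideanSpace ℝ (Fin N))) (r := 1)).2 zero_le_one
      exact ⟨⟨x, hx⟩, Set.mem_univ _⟩
    have hcont : Continuous (fun ω : sphere (0 : EuclideanSpace ℝ (Fin N)) 1 =>
        (fun x => u x * u x + v x * v x) (r • (ω : EuclideanSpace ℝ (Fin N)))) := by fun_prop
    obtain ⟨ω₀, _, hω⟩ := isCompact_univ.exists_isMinOn hne hcont.continuousOn
    have hlt := hInt.measure_ge_lt_top (hp (r • (ω₀ : EuclideanSpace ℝ (Fin N))))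
    have : {ω : sphere (0 : EuclideanSpace ℝ (Fin N)) 1 | u (r • (ω₀ : EuclideanSpace ℝ (Fin N))) * u (r • (ω₀ : EuclideanSpace ℝ (Fin N)))
        + v (r • (ω₀ : EuclideanSpace ℝ (Fin N))) * v (r • (ω₀ : EuclideanSpace ℝ (Fin N))) ≤
        (fun x => u x * u x + v x * v x) (r • (ω : EuclideanSpace ℝ (Fin N)))} = Set.univ :=
      Set.eq_univ_of_forall fun ω => hω (Set.mem_univ ω)
    rw [this, hfin] at hlt
    exact lt_irrefl _ hlt
  · obtain ⟨c, hc1, hc⟩ := alm_hausdorff_eq hN hfin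
    have hc1' : (1 : ℝ) ≤ c := by exact_mod_cast hc1
    have hfn : ∀ r, 0 < r → freq u v r = n r / c := by
      intro r hr
      rw [hfreq r hr, hc, integral_smul_nnreal_measure]
      simp only [hn, almI, NNReal.smul_def, smul_eq_mul]
      rw [div_div]
      congr 1
      ring
    have hmm : Monotone (fun r => n (max r 1)) := by
      intro a b hab
      exact hmono (Set.mem_Ioi.2 (lt_of_lt_of_le one_pos (le_max_right _ _)))
        (Set.mem_Ioi.2 (lt_of_lt_of_le one_pos (le_max_right _ _)))
        (max_le_max_right 1 hab)
    have hbb : BddAbove (Set.range fun r => n (max r 1)) := by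
      refine ⟨α, ?_⟩
      rintro _ ⟨r, rfl⟩
      exact hbd _ (lt_of_lt_of_le one_pos (le_max_right _ _))
    have ht := tendsto_atTop_ciSup hmm hbb
    set L := ⨆ r, n (max r 1)
    have hLα : L ≤ α := ciSup_le fun r => hbd _ (lt_of_lt_of_le one_pos (le_max_right _ _))
    have hL0 : 0 ≤ L := (hnn _ (lt_of_lt_of_le one_pos (le_max_right _ _))).trans (le_ciSup hbb 1)
    refine ⟨L / c, ?_, (div_le_self hL0 hc1').trans hLα⟩
    refine (ht.div_const (c : ℝ)).congr' ?_
    filter_upwards [eventually_ge_atTop 1] with r hr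
    rw [hfn r (by linarith), max_eq_left hr]
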